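/- Let f : (ℝ/ℤ) × [0,1] → (ℝ/ℤ) × [0,1] be a homeomorphism of the closed annulus that preserves the product of Haar measure on ℝ/ℤ with Lebesgue measure on [0,1] and that maps each boundary circle (ℝ/ℤ)×{0} and (ℝ/ℤ)×{1} onto itself. Let F : ℝ × [0,1] → ℝ × [0,1] be a lift of f, i.e. a continuous map satisfying (π×id)∘F = f∘(π×id), where π : ℝ → ℝ/ℤ is the covering projection, and F(x+1,y) = F(x,y) + (1,0) for all (x,y). Assume there exist real numbers ρ₀ and ρ₁ such that for every x ∈ ℝ one has limₙ→∞ p(Fⁿ(x,0))/n = ρ₀ and limₙ→∞ p(Fⁿ(x,1))/n = ρ₁, where p : ℝ×[0,1] → ℝ is the projection onto the first coordinate. If there exists an integer k with min(ρ₀,ρ₁) < k < max(ρ₀,ρ₁), then f has at least two distinct fixed points. -/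

import Mathlib

open MeasureTheory Filter Topology
section
namespace PB

theorem log_unique {α : Type*} [TopologicalSpace α] {s : Set α} (hs : IsPreconnected s)
    {L1 L2 : α → ℂ} (h1 : ContinuousOn L1 s) (h2 : ContinuousOn L2 s)
    (h : ∀ x ∈ s, Complex.exp (L1 x) = Complex.exp (L2 x)) {x y : α} (hx : x ∈ s) (hy : y ∈ s) :
    L1 x - L2 x = L1 y - L2 y := by
  have key := Complex.isCoveringMap_exp.eqOn_of_comp_eqOn (g₁ := L1)
    (g₂ := fun z => L2 z + (L1 x - L2 x)) hs h1 (h2.add continuousOn_const) ?_ hx (by simp) hy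
  · simp only at key
    rw [key]; ring
  · intro z hz
    simp only [Function.comp, Subtype.mk.injEq]
    rw [Complex.exp_add, Complex.exp_sub, h x hx, div_self (Complex.exp_ne_zero _), mul_one, h z hz]

theorem lift_log {α : Type*} [TopologicalSpace α] (S : Set α) (Φ : ℝ → α → ℂ)
    (hΦ : ContinuousOn (fun q : ℝ × α => Φ q.1 q.2) (Set.Icc 0 1 ×ˢ S))
    (hne : ∀ t ∈ Set.Icc (0:ℝ) 1, ∀ a ∈ S, Φ t a ≠ 0) (L0 : α → ℂ) (hL0 : ContinuousOn L0 S)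
    (hexp : ∀ a ∈ S, Complex.exp (L0 a) = Φ 0 a) :
    ∃ L : α → ℂ, ContinuousOn L S ∧ (∀ a ∈ S, Complex.exp (L a) = Φ 1 a) ∧
      ∀ a ∈ S, (∀ t ∈ Set.Icc (0:ℝ) 1, Φ t a = Φ 0 a) → L a = L0 a := by
  classical
  let H : C(unitInterval × S, {z : ℂ // z ≠ 0}) :=
    ⟨fun q => ⟨Φ q.1 q.2, hne _ q.1.2 _ q.2.2⟩, by
      refine Continuous.subtype_mk ?_ _
      exact hΦ.comp_continuous (f := fun q : unitInterval × S => ((q.1 : ℝ), (q.2 : α)))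
        (by fun_prop) (fun q => ⟨q.1.2, q.2.2⟩)⟩
  let f : C(S, ℂ) := ⟨fun a => L0 a, hL0.domRestrict⟩
  have H0 : ∀ a, H (0, a) = (fun z : ℂ ↦ (⟨_, z.exp_ne_zero⟩ : {z : ℂ // z ≠ 0})) (f a) := by
    intro a
    apply Subtype.ext
    exact (hexp a a.2).symm
  let G := Complex.isCoveringMap_exp.liftHomotopy H f H0
  have hG := Complex.isCoveringMap_exp.liftHomotopy_lifts H f H0
  have hG0 := Complex.isCoveringMap_exp.liftHomotopy_zero H f H0
  have hGe : ∀ t a, Complex.exp (G (t, a)) = Φ t a := fun t a =>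
    congrArg Subtype.val (congrFun hG (t, a))
  refine ⟨fun a => if h : a ∈ S then G (1, ⟨a, h⟩) else 0, ?_, ?_, ?_⟩
  · rw [continuousOn_iff_continuous_domRestrict]
    have : S.domRestrict (fun a => if h : a ∈ S then G (1, ⟨a, h⟩) else 0) = fun a => G (1, a) := by
      ext a; simp [Set.domRestrict]
    rw [this]; fun_prop
  · intro a ha
    simp only [ha, dif_pos]
    simpa using hGe 1 ⟨a, ha⟩
  · intro a ha hc
    simp only [ha, dif_pos]
    have := log_unique (s := (Set.univ : Set unitInterval)) isPreconnected_univ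
      (L1 := fun t => G (t, ⟨a, ha⟩)) (L2 := fun t => L0 a)
      (by apply Continuous.continuousOn; fun_prop) continuousOn_const
      (by intro t _; rw [hGe, hexp a ha]; exact hc t t.2) (Set.mem_univ 1) (Set.mem_univ 0)
    have h0 : G (0, ⟨a, ha⟩) = L0 a := hG0 _
    simp only [h0, sub_self] at this
    exact sub_eq_zero.mp this
end PB
end

section
namespace PB

structure Str (F : ℂ → ℂ) : Prop where
  cont : Continuous F
  nonneg : ∀ p, 0 ≤ (F p).im
  le_one : ∀ p, (F p).im ≤ 1
  bot : ∀ p, p.im ≤ 0 → (F p).im = 0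
  top : ∀ p, 1 ≤ p.im → (F p).im = 1
  clampBot : ∀ x y : ℝ, y ≤ 0 → F ⟨x, y⟩ = F ⟨x, 0⟩
  clampTop : ∀ x y : ℝ, 1 ≤ y → F ⟨x, y⟩ = F ⟨x, 1⟩
  inj : ∀ p q, 0 ≤ p.im → p.im ≤ 1 → 0 ≤ q.im → q.im ≤ 1 → F p = F q → p = q
  per : ∀ p, F (p + 1) = F p + 1
  left : ∀ p, p.im ≤ 0 → (F p).re < p.re
  right : ∀ p, 1 ≤ p.im → p.re < (F p).re
  mono : ∀ x x' : ℝ, x < x' → (F ⟨x, 0⟩).re < (F ⟨x', 0⟩).re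

theorem half_log {F : ℂ → ℂ} (hF : Continuous F) (hper : ∀ p, F (p + 1) = F p + 1)
    (S : Set ℂ) (b : ℝ)
    (hS : ∀ p ∈ S, ∀ t ∈ Set.Icc (0:ℝ) 1, (⟨p.re, p.im + (1 - t) * (b - p.im)⟩ : ℂ) ∈ S)
    (hne : ∀ p ∈ S, F p ≠ p) (hS1 : ∀ p ∈ S, p + 1 ∈ S)
    (l : ℝ → ℂ) (hl : Continuous l) (hl1 : ∀ x, l (x + 1) = l x)
    (hle : ∀ x, Complex.exp (l x) = F ⟨x, b⟩ - ⟨x, b⟩) :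
    ∃ L : ℂ → ℂ, ContinuousOn L S ∧ (∀ p ∈ S, Complex.exp (L p) = F p - p) ∧
      (∀ p ∈ S, p.im = b → L p = l p.re) ∧ (∀ p ∈ S, L (p + 1) = L p) := by
  set q : ℝ → ℂ → ℂ := fun t p => ⟨p.re, p.im + (1 - t) * (b - p.im)⟩ with hq
  have hqc : Continuous (fun z : ℝ × ℂ => q z.1 z.2) := by
    have : (fun z : ℝ × ℂ => q z.1 z.2) =
        fun z => ((z.2.re : ℝ) : ℂ) + ((z.2.im + (1 - z.1) * (b - z.2.im) : ℝ) : ℂ) * Complex.I := by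
      ext z; apply Complex.ext <;> simp [hq]
    rw [this]; fun_prop
  have hq1 : ∀ p, q 1 p = p := fun p => by apply Complex.ext <;> simp [hq]
  have hq0 : ∀ p, q 0 p = ⟨p.re, b⟩ := fun p => by apply Complex.ext <;> simp [hq]
  obtain ⟨L, hLc, hLe, hLk⟩ := lift_log S (fun t p => F (q t p) - q t p)
    (by apply Continuous.continuousOn; exact (hF.comp hqc).sub hqc)
    (fun t ht p hp => sub_ne_zero.mpr (hne _ (hS p hp t ht)))
    (fun p => l p.re) (by apply Continuous.continuousOn; fun_prop)
    (fun p hp => by simp only [hq0]; exact hle _)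
  have hLb : ∀ p ∈ S, p.im = b → L p = l p.re := by
    intro p hp hb
    apply hLk p hp
    intro t _
    have : ∀ t, q t p = p := fun t => by apply Complex.ext <;> simp [hq, hb]
    simp [this]
  simp only [hq1] at hLe
  refine ⟨L, hLc, hLe, hLb, ?_⟩
  intro p hp
  have hm : ∀ t ∈ Set.Icc (0:ℝ) 1, q t p ∈ S := hS p hp
  have hqt : Continuous fun t => q t p := hqc.comp (by fun_prop : Continuous fun t : ℝ => (t, p))
  have := log_unique (s := Set.Icc (0:ℝ) 1) isPreconnected_Icc
    (L1 := fun t => L (q t p + 1)) (L2 := fun t => L (q t p))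
    (hLc.comp (by fun_prop) (fun t ht => hS1 _ (hm t ht)))
    (hLc.comp (by fun_prop) hm)
    (fun t ht => by
      rw [hLe _ (hm t ht), hLe _ (hS1 _ (hm t ht)), hper]; ring)
    (x := 1) (y := 0) (by simp) (by simp)
  simp only [hq1] at this
  rw [hLb (q 0 p) (hm 0 (by simp)) (by simp [hq0]),
    hLb (q 0 p + 1) (hS1 _ (hm 0 (by simp))) (by simp [hq0])] at this
  simp only [hq0, Complex.add_re, Complex.one_re, hl1, sub_self] at this
  exact sub_eq_zero.mp this

theorem exists_log {F : ℂ → ℂ} (h : Str F) (x0 y0 : ℝ) (hy0 : 0 ≤ y0) (hy1 : y0 ≤ 1)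
    (hfix : ∀ p, F p = p → p.im = y0 ∧ ∃ j : ℤ, p.re = x0 + j) :
    ∃ (L : ℂ → ℂ) (κ : ℝ), ContinuousOn L {p | 0 ≤ p.im ∧ p.im ≤ 1 ∧ F p ≠ p} ∧
      (∀ p, 0 ≤ p.im → p.im ≤ 1 → F p ≠ p → Complex.exp (L p) = F p - p) ∧
      (∀ p, p.im = 0 → (L p).im = κ) ∧ (∀ p, p.im = 1 → (L p).im = 0) := by
  classical
  have hbne : ∀ p, p.im ≤ 0 → F p ≠ p := fun p hp he => by
    have := h.left p hp; rw [he] at this; exact lt_irrefl _ this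
  have htne : ∀ p, 1 ≤ p.im → F p ≠ p := fun p hp he => by
    have := h.right p hp; rw [he] at this; exact lt_irrefl _ this
  have hinc : ∀ b : ℝ, Continuous fun x : ℝ => (⟨x, b⟩ : ℂ) := fun b => by
    have : (fun x : ℝ => (⟨x, b⟩ : ℂ)) = fun x : ℝ => (x : ℂ) + (b : ℂ) * Complex.I := by
      ext x; apply Complex.ext <;> simp
    rw [this]; fun_prop
  have hshift : ∀ x b : ℝ, (⟨x + 1, b⟩ : ℂ) = ⟨x, b⟩ + 1 := fun x b => by
    apply Complex.ext <;> simp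
  have hper1 : ∀ p, (F (p + 1) ≠ p + 1) ↔ F p ≠ p := fun p => by rw [h.per]; simp
  -- upper log
  obtain ⟨Lu, huc, hue, hub, hup⟩ := half_log h.cont h.per
    {p | y0 ≤ p.im ∧ p.im ≤ 1 ∧ F p ≠ p} 1
    (by
      rintro p ⟨h1, h2, h3⟩ t ⟨ht0, ht1⟩
      have hle : p.im ≤ p.im + (1 - t) * (1 - p.im) := by nlinarith
      refine ⟨by simp only; linarith, by simp only; nlinarith, fun he => ?_⟩
      have hy := (hfix _ he).1
      simp only at hy
      have : (1 - t) * (1 - p.im) = 0 := by nlinarith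
      rw [this] at he
      apply h3
      simpa using he)
    (fun p hp => hp.2.2)
    (by rintro p ⟨h1, h2, h3⟩; exact ⟨by simpa using h1, by simpa using h2, (hper1 p).2 h3⟩)
    (fun x => Complex.log (F ⟨x, 1⟩ - ⟨x, 1⟩))
    (by
      refine Continuous.clog ((h.cont.comp (hinc 1)).sub (hinc 1)) (fun x => Or.inl ?_)
      have := h.right ⟨x, 1⟩ le_rfl
      simpa using this)
    (by intro x; simp only [hshift, h.per]; congr 1; ring)
    (fun x => Complex.exp_log (sub_ne_zero.mpr (htne _ le_rfl)))
  obtain ⟨Ld, hdc, hde, hdb, hdp⟩ := half_log h.cont h.per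
    {p | 0 ≤ p.im ∧ p.im ≤ y0 ∧ F p ≠ p} 0
    (by
      rintro p ⟨h1, h2, h3⟩ t ⟨ht0, ht1⟩
      have hle : p.im + (1 - t) * (0 - p.im) ≤ p.im := by nlinarith
      refine ⟨by simp only; nlinarith, by simp only; linarith, fun he => ?_⟩
      have hy := (hfix _ he).1
      simp only at hy
      have : (1 - t) * (0 - p.im) = 0 := by nlinarith
      rw [this] at he
      apply h3
      simpa using he)
    (fun p hp => hp.2.2)
    (by rintro p ⟨h1, h2, h3⟩; exact ⟨by simpa using h1, by simpa using h2, (hper1 p).2 h3⟩)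
    (fun x => Complex.log (-(F ⟨x, 0⟩ - ⟨x, 0⟩)) + Real.pi * Complex.I)
    (by
      refine (Continuous.clog ((h.cont.comp (hinc 0)).sub (hinc 0)).neg (fun x => Or.inl ?_)).add
        continuous_const
      have := h.left ⟨x, 0⟩ le_rfl
      simpa using this)
    (by intro x; simp only [hshift, h.per]; congr 3; ring)
    (fun x => by
      rw [Complex.exp_add, Complex.exp_pi_mul_I,
        Complex.exp_log (neg_ne_zero.mpr (sub_ne_zero.mpr (hbne _ le_rfl)))]; ring)
  -- difference on the middle line
  set A : Set ℝ := {x | F ⟨x, y0⟩ ≠ ⟨x, y0⟩} with hA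
  set D : ℝ → ℂ := fun x => Lu ⟨x, y0⟩ - Ld ⟨x, y0⟩ with hD
  have hU : ∀ x ∈ A, (⟨x, y0⟩ : ℂ) ∈ {p : ℂ | y0 ≤ p.im ∧ p.im ≤ 1 ∧ F p ≠ p} :=
    fun x hx => ⟨le_rfl, hy1, hx⟩
  have hDn : ∀ x ∈ A, (⟨x, y0⟩ : ℂ) ∈ {p : ℂ | 0 ≤ p.im ∧ p.im ≤ y0 ∧ F p ≠ p} :=
    fun x hx => ⟨hy0, le_rfl, hx⟩
  have hDp : ∀ x ∈ A, x + 1 ∈ A ∧ D (x + 1) = D x := by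
    intro x hx
    refine ⟨?_, ?_⟩
    · simp only [hA, Set.mem_ofPred_eq, hshift, hper1]; exact hx
    · simp only [hD, hshift, hup _ (hU x hx), hdp _ (hDn x hx)]
  have hAm : ∀ x, x + 1 ∈ A → x ∈ A := by
    intro x hx
    simp only [hA, Set.mem_ofPred_eq, hshift, hper1] at hx; exact hx
  have hDz : ∀ (j : ℤ) (x : ℝ), x ∈ A → x + j ∈ A ∧ D (x + j) = D x := by
    intro j
    induction j using Int.induction_on with
    | zero => intro x hx; simpa using hx
    | succ n ih =>
      intro x hx
      obtain ⟨i1, i2⟩ := ih x hx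
      obtain ⟨i3, i4⟩ := hDp _ i1
      push_cast at *
      rw [← add_assoc]; exact ⟨i3, i4.trans i2⟩
    | pred n ih =>
      intro x hx
      obtain ⟨i1, i2⟩ := ih x hx
      push_cast at *
      have e : x + (-(n:ℝ) - 1) + 1 = x + -(n:ℝ) := by ring
      have i3 := hAm (x + (-(n:ℝ) - 1)) (by rw [e]; exact i1)
      exact ⟨i3, by rw [← (hDp _ i3).2, e, i2]⟩
  have hoff : ∀ x ∈ Set.Ioo x0 (x0 + 1), x ∈ A := by
    intro x hx he
    obtain ⟨j, hj⟩ := (hfix _ he).2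
    simp only at hj
    have h1 : (0:ℝ) < j := by linarith [hx.1]
    have h2 : (j:ℝ) < 1 := by linarith [hx.2]
    have h1' : 0 < j := by exact_mod_cast h1
    have h2' : j < 1 := by exact_mod_cast h2
    omega
  have hDeq : ∀ s : Set ℝ, IsPreconnected s → s ⊆ A → ∀ x ∈ s, ∀ y ∈ s, D x = D y := by
    intro s hs hsA x hx y hy
    refine log_unique hs (L1 := fun x => Lu ⟨x, y0⟩) (L2 := fun x => Ld ⟨x, y0⟩)
      (huc.comp (hinc y0).continuousOn (fun x hx => hU x (hsA hx)))
      (hdc.comp (hinc y0).continuousOn (fun x hx => hDn x (hsA hx)))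
      (fun x hx => by rw [hue _ (hU x (hsA hx)), hde _ (hDn x (hsA hx))]) hx hy
  have hmid : x0 + 1/2 ∈ Set.Ioo x0 (x0 + 1) := by constructor <;> linarith
  have hconst : ∀ x ∈ A, D x = D (x0 + 1/2) := by
    intro x hx
    obtain ⟨j1, j2⟩ := hDz (-⌊x - x0⌋) x hx
    rw [← j2]
    have f1 := Int.floor_le (x - x0)
    have f2 := Int.lt_floor_add_one (x - x0)
    push_cast at *
    by_cases hx0 : x0 ∈ A
    · refine hDeq (Set.Ico x0 (x0+1)) isPreconnected_Ico ?_ _ ⟨by linarith, by linarith⟩ _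
        (Set.Ioo_subset_Ico_self hmid)
      intro y hy
      rcases eq_or_lt_of_le hy.1 with he | hlt
      · rw [← he]; exact hx0
      · exact hoff y ⟨hlt, hy.2⟩
    · refine hDeq (Set.Ioo x0 (x0+1)) isPreconnected_Ioo hoff _ ⟨?_, by linarith⟩ _ hmid
      refine lt_of_le_of_ne (by linarith) ?_
      intro he; rw [he] at hx0; exact hx0 j1
  set c := D (x0 + 1/2) with hc
  refine ⟨fun p => if y0 ≤ p.im then Lu p else Ld p + c, Real.pi + c.im, ?_, ?_, ?_, ?_⟩
  · rw [continuousOn_iff_continuous_domRestrict]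
    refine continuous_if_le (f' := fun p : {p : ℂ | 0 ≤ p.im ∧ p.im ≤ 1 ∧ F p ≠ p} => Lu p)
      (g' := fun p : {p : ℂ | 0 ≤ p.im ∧ p.im ≤ 1 ∧ F p ≠ p} => Ld p + c)
      continuous_const (by fun_prop) ?_ ?_ ?_
    · exact huc.comp (by fun_prop) (fun p hp => ⟨hp, p.2.2.1, p.2.2.2⟩)
    · exact (hdc.comp (by fun_prop) (fun p hp => ⟨p.2.1, hp, p.2.2.2⟩)).add continuousOn_const
    · intro p hp
      have hpe : (p : ℂ) = ⟨(p:ℂ).re, y0⟩ := by apply Complex.ext <;> simp [hp]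
      have hpA : (p:ℂ).re ∈ A := by
        simp only [hA, Set.mem_ofPred_eq]; rw [← hpe]; exact p.2.2.2
      have := hconst _ hpA
      simp only [hD, ← hpe] at this
      rw [← this]; ring
  · intro p h0 h1 hne
    by_cases hp : y0 ≤ p.im
    · simp only [hp, if_true]; exact hue p ⟨hp, h1, hne⟩
    · simp only [hp, if_false]
      have hcA := hoff _ hmid
      have : Complex.exp c = 1 := by
        rw [hc]; simp only [hD]
        rw [Complex.exp_sub, hue _ (hU _ hcA), hde _ (hDn _ hcA), div_self]
        exact sub_ne_zero.mpr hcA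
      rw [Complex.exp_add, this, mul_one]
      exact hde p ⟨h0, (not_le.mp hp).le, hne⟩
  · intro p hp
    have hd : (Ld p).im = Real.pi := by
      rw [hdb p ⟨hp.ge, by rw [hp]; exact hy0, hbne _ hp.le⟩ hp]
      have hl := h.left ⟨p.re, 0⟩ le_rfl
      have hb := h.bot ⟨p.re, 0⟩ le_rfl
      simp only [Complex.add_im, Complex.log_im]
      have : Complex.arg (-(F ⟨p.re, 0⟩ - ⟨p.re, 0⟩)) = 0 := by
        rw [Complex.arg_eq_zero_iff]
        simp only at hl hb
        constructor <;> simp [hb, hl.le]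
      rw [this]; simp
    beta_reduce
    split_ifs with hy
    · have hpe : p = ⟨p.re, y0⟩ := by
        apply Complex.ext
        · simp
        · simp only; linarith
      have hpA : p.re ∈ A := by
        simp only [hA, Set.mem_ofPred_eq]; rw [← hpe]; exact hbne _ hp.le
      have := hconst _ hpA
      simp only [hD, ← hpe] at this
      rw [← this]; simp [hd]
    · simp [hd]
  · intro p hp
    beta_reduce
    rw [if_pos (by rw [hp]; exact hy1), hub p ⟨by rw [hp]; exact hy1, hp.le, htne _ hp.ge⟩ hp]
    have hl := h.right ⟨p.re, 1⟩ le_rfl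
    have hb := h.top ⟨p.re, 1⟩ le_rfl
    rw [Complex.log_im, Complex.arg_eq_zero_iff]
    simp only at hl hb
    constructor <;> simp [hb, hl.le]
end PB
end

section
namespace PB

theorem coe_add_int (x : ℝ) (j : ℤ) :
    ((x + j : ℝ) : AddCircle (1:ℝ)) = (x : AddCircle (1:ℝ)) := by
  rw [AddCircle.coe_add, add_eq_left, AddCircle.coe_eq_zero_iff]
  exact ⟨j, by simp⟩

noncomputable def phi (x0 : ℝ) (a : AddCircle (1:ℝ)) : ℝ := max 0 (‖a - (x0 : AddCircle (1:ℝ))‖ - 1/4)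

theorem phi_nonneg (x0 : ℝ) (a) : 0 ≤ phi x0 a := le_max_left _ _

theorem phi_le (x0 : ℝ) (a) : phi x0 a ≤ 1 := by
  have := AddCircle.norm_le_half_period (1:ℝ) (x := a - (x0 : AddCircle (1:ℝ))) one_ne_zero
  simp only [abs_one] at this
  exact max_le zero_le_one (by linarith)

theorem phi_cont (x0 : ℝ) : Continuous (phi x0) := by unfold phi; fun_prop

/-- the sheared extended map -/
noncomputable def Hm (F : ℂ → ℂ) (x0 ε : ℝ) (p : ℂ) : ℂ :=
  ⟨(F p).re, (F p).im + min p.im 0 + 2 * max (p.im - 1) 0 +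
    ε * phi x0 ((F p).re : AddCircle (1:ℝ))⟩

theorem Hm_cont {F : ℂ → ℂ} (h : Continuous F) (x0 ε : ℝ) : Continuous (Hm F x0 ε) := by
  have e : Hm F x0 ε = fun p => (((F p).re : ℝ) : ℂ) + (((F p).im + min p.im 0 +
      2 * max (p.im - 1) 0 + ε * phi x0 ((F p).re : AddCircle (1:ℝ)) : ℝ) : ℂ) * Complex.I := by
    ext p; apply Complex.ext <;> simp [Hm]
  have h2 : Continuous fun p => phi x0 (((F p).re : ℝ) : AddCircle (1:ℝ)) :=
    (phi_cont x0).comp ((AddCircle.continuous_mk' 1).comp (by fun_prop))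
  rw [e]; fun_prop

noncomputable def cl (p : ℂ) : ℂ := ⟨p.re, max 0 (min p.im 1)⟩

theorem cl_cont : Continuous cl := by
  have e : cl = fun p => ((p.re : ℝ) : ℂ) + ((max 0 (min p.im 1) : ℝ) : ℂ) * Complex.I := by
    ext p; apply Complex.ext <;> simp [cl]
  rw [e]; fun_prop

theorem cl_mem (p : ℂ) : 0 ≤ (cl p).im ∧ (cl p).im ≤ 1 := by
  simp [cl]

theorem F_cl {F : ℂ → ℂ} (h : Str F) (p : ℂ) : F (cl p) = F p := by
  unfold cl
  rcases le_total p.im 0 with h0 | h0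
  · rw [max_eq_left ((min_le_left _ _).trans h0)]
    exact (h.clampBot p.re p.im h0).symm
  · rcases le_total p.im 1 with h1 | h1
    · rw [min_eq_left h1, max_eq_right h0]
    · rw [min_eq_right h1, max_eq_right zero_le_one]
      exact (h.clampTop p.re p.im h1).symm

theorem Hm_inj {F : ℂ → ℂ} (h : Str F) (x0 ε : ℝ) : Function.Injective (Hm F x0 ε) := by
  intro p q hpq
  have hre : (F p).re = (F q).re := by simpa [Hm] using congrArg Complex.re hpq
  have him := congrArg Complex.im hpq
  simp only [Hm] at him
  rw [hre] at him
  have him' : (F p).im + min p.im 0 + 2 * max (p.im - 1) 0 =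
    (F q).im + min q.im 0 + 2 * max (q.im - 1) 0 := by linarith
  have p0 := h.nonneg p
  have p1 := h.le_one p
  have q0 := h.nonneg q
  have q1 := h.le_one q
  have key : (F p).im = (F q).im ∧ min p.im 0 = min q.im 0 ∧ max (p.im - 1) 0 = max (q.im - 1) 0 := by
    have pb := h.bot p
    have pt := h.top p
    have qb := h.bot q
    have qt := h.top q
    rcases le_or_gt p.im 0 with a | a <;> rcases le_or_gt q.im 0 with b | b <;>
    rcases le_or_gt p.im 1 with c | c <;> rcases le_or_gt q.im 1 with d | d <;>
    (try (exfalso; linarith)) <;> simp [*, le_of_lt] at * <;> 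
    (try grind)
  obtain ⟨k1, k2, k3⟩ := key
  have hFF : F (cl p) = F (cl q) := by
    rw [F_cl h, F_cl h]; exact Complex.ext hre k1
  have := h.inj _ _ (cl_mem p).1 (cl_mem p).2 (cl_mem q).1 (cl_mem q).2 hFF
  have e1 := congrArg Complex.re this
  have e2 := congrArg Complex.im this
  simp only [cl] at e1 e2
  apply Complex.ext e1
  have hid : ∀ y : ℝ, y = max 0 (min y 1) + min y 0 + max (y - 1) 0 := by
    intro y; grind
  rw [hid p.im, hid q.im, e2, k2, k3]

theorem exists_eps {F : ℂ → ℂ} (h : Str F) (x0 : ℝ)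
    (hfix : ∀ p, F p = p → ∃ j : ℤ, p.re = x0 + j) :
    ∃ ε > 0, ∀ p, 0 ≤ p.im → p.im ≤ 1 → F p ≠ p →
      ε * phi x0 ((F p).re : AddCircle (1:ℝ)) < ‖F p - p‖ := by
  set K : Set ℂ := (Set.Icc (0:ℝ) 1 ×ℂ Set.Icc (0:ℝ) 1) ∩
    {p | 1/4 ≤ ‖(((F p).re : ℝ) : AddCircle (1:ℝ)) - (x0 : AddCircle (1:ℝ))‖} with hK
  have hcl : IsClosed {p | 1/4 ≤ ‖(((F p).re : ℝ) : AddCircle (1:ℝ)) - (x0 : AddCircle (1:ℝ))‖} := by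
    have h2 : Continuous fun p => (((F p).re : ℝ) : AddCircle (1:ℝ)) :=
      (AddCircle.continuous_mk' 1).comp (by have := h.cont; fun_prop)
    exact isClosed_le continuous_const (by fun_prop)
  have hKc : IsCompact K := (isCompact_Icc.reProdIm isCompact_Icc).inter_right hcl
  obtain ⟨m, hm0, hm⟩ := hKc.exists_forall_le' (f := fun p => ‖F p - p‖) (a := 0)
    (by have := h.cont; fun_prop) (by
      rintro p ⟨-, hp⟩
      rw [norm_pos_iff, sub_ne_zero]
      intro he
      obtain ⟨j, hj⟩ := hfix p he
      rw [Set.mem_ofPred_eq, he, hj] at hp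
      have : ((x0 + j : ℝ) : AddCircle (1:ℝ)) - (x0 : AddCircle (1:ℝ)) = 0 := by
        rw [coe_add_int, sub_self]
      rw [this] at hp
      norm_num at hp)
  have hperz : ∀ (j : ℤ) p, F (p + j) = F p + j := by
    intro j
    induction j using Int.induction_on with
    | zero => intro p; simp
    | succ n ih =>
      intro p; push_cast at *; rw [← add_assoc, h.per, ih]; ring
    | pred n ih =>
      intro p; push_cast at *
      have := h.per (p + (-(n:ℂ) - 1))
      rw [show p + (-(n:ℂ) - 1) + 1 = p + -(n:ℂ) by ring, ih] at this
      linear_combination -this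
  refine ⟨m, hm0, fun p h0 h1 hne => ?_⟩
  by_cases hn : 1/4 ≤ ‖(((F p).re : ℝ) : AddCircle (1:ℝ)) - (x0 : AddCircle (1:ℝ))‖
  · have hp' := hperz (-⌊p.re⌋) p
    have hmem : p + ((-⌊p.re⌋ : ℤ) : ℂ) ∈ K := by
      refine ⟨⟨⟨?_, ?_⟩, ?_⟩, ?_⟩
      · simp [Int.floor_le]
      · simp; linarith [Int.lt_floor_add_one p.re]
      · simp [h0, h1]
      · rw [Set.mem_ofPred_eq, hp']
        simp only [Complex.add_re, Complex.intCast_re]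
        have : (((F p).re + ((-⌊p.re⌋ : ℤ) : ℝ) : ℝ) : AddCircle (1:ℝ)) = ((F p).re : ℝ) := by
          exact coe_add_int _ _
        rw [this]; exact hn
    have := hm _ hmem
    rw [hp', add_sub_add_right_eq_sub] at this
    refine lt_of_lt_of_le ?_ this
    have hb := AddCircle.norm_le_half_period (1:ℝ)
      (x := (((F p).re : ℝ) : AddCircle (1:ℝ)) - (x0 : AddCircle (1:ℝ))) one_ne_zero
    simp only [abs_one] at hb
    have : phi x0 ((F p).re : AddCircle (1:ℝ)) ≤ 1/2 := max_le (by norm_num) (by linarith)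
    nlinarith
  · have : phi x0 ((F p).re : AddCircle (1:ℝ)) = 0 := max_eq_left (by linarith)
    rw [this, mul_zero, norm_pos_iff, sub_ne_zero]; exact hne

theorem re_div_pos {u v : ℂ} (hv : v ≠ 0) (h : ‖u - v‖ < ‖v‖) : 0 < (u / v).re := by
  have h1 : u / v = 1 + (u - v) / v := by field_simp; ring
  have h2 : ‖(u - v) / v‖ < 1 := by
    rw [norm_div, div_lt_one (norm_pos_iff.mpr hv)]; exact h
  have h3 := (abs_le.mp (Complex.abs_re_le_norm ((u - v) / v))).1
  rw [h1, Complex.add_re, Complex.one_re]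
  linarith

theorem ratio_pos {F : ℂ → ℂ} (h : Str F) {x0 ε : ℝ} (hε : 0 < ε)
    (heps : ∀ p, 0 ≤ p.im → p.im ≤ 1 → F p ≠ p →
      ε * phi x0 ((F p).re : AddCircle (1:ℝ)) < ‖F p - p‖) (p : ℂ) (hne : F (cl p) ≠ cl p) :
    0 < ((Hm F x0 ε p - p) / (F (cl p) - cl p)).re := by
  have hph := mul_nonneg hε.le (phi_nonneg x0 ((F p).re : AddCircle (1:ℝ)))
  rcases le_or_gt p.im 1 with h1 | h1
  · apply re_div_pos (sub_ne_zero.mpr hne)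
    have := heps _ (cl_mem p).1 (cl_mem p).2 hne
    refine lt_of_le_of_lt (le_of_eq ?_) this
    rw [F_cl h]
    have e : Hm F x0 ε p - p - (F p - cl p) =
        ((ε * phi x0 ((F p).re : AddCircle (1:ℝ)) : ℝ) : ℂ) * Complex.I := by
      apply Complex.ext
      · simp [Hm, cl]
      · simp only [Hm, cl, Complex.sub_im, Complex.mul_im, Complex.ofReal_re, Complex.I_im,
          Complex.ofReal_im, Complex.I_re]
        grind
    rw [e, norm_mul, Complex.norm_I, mul_one, Complex.norm_real, Real.norm_of_nonneg hph]
  · have hr := h.right _ h1.le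
    have hc : cl p = ⟨p.re, 1⟩ := by simp [cl, h1.le]
    have ht := h.top p h1.le
    rw [F_cl h, Complex.div_re]
    have e1 : (F p - cl p).im = 0 := by simp [hc, ht]
    have e2 : (F p - cl p).re = (F p).re - p.re := by simp [hc]
    have e3 : (Hm F x0 ε p - p).re = (F p).re - p.re := by simp [Hm]
    rw [e1, e2, e3]
    have : F p - cl p ≠ 0 := by rw [← F_cl h p]; exact sub_ne_zero.mpr hne
    have := Complex.normSq_pos.mpr this
    have h5 : 0 < (F p).re - p.re := by linarith
    have h6 := div_pos (mul_pos h5 h5) this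
    simpa using h6
end PB
end

section
namespace PB

/-- initial arc -/
noncomputable def arc (xm a : ℝ) (z : ℂ) (t : ℝ) : ℂ :=
  ⟨xm + min (2 * t) 1 * (z.re - xm), a + max (2 * t - 1) 0 * (z.im - a)⟩

theorem arc_cont (xm a : ℝ) (z : ℂ) : Continuous (arc xm a z) := by
  have e : arc xm a z = fun t => ((xm + min (2 * t) 1 * (z.re - xm) : ℝ) : ℂ) +
      ((a + max (2 * t - 1) 0 * (z.im - a) : ℝ) : ℂ) * Complex.I := by
    ext t; apply Complex.ext <;> simp [arc]
  rw [e]; fun_prop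

theorem bot_re {F : ℂ → ℂ} (h : Str F) (p : ℂ) (hp : p.im ≤ 0) : (F p).re = (F ⟨p.re, 0⟩).re := by
  rw [← h.clampBot p.re p.im hp]

theorem sep {F : ℂ → ℂ} (h : Str F) {x0 ε : ℝ} (hε : 0 < ε) (z : ℂ) (hz0 : 0 < z.im)
    (hz1 : z.im < ε * phi x0 (z.re : AddCircle (1:ℝ))) (xm : ℝ) (hxm : (F ⟨xm, 0⟩).re = z.re)
    (a : ℝ) (ha : a = z.im - ε * phi x0 (z.re : AddCircle (1:ℝ))) :
    Hm F x0 ε (arc xm a z 0) = z ∧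
    ∀ m : ℕ, ∀ t ∈ Set.Ico (0:ℝ) 1, ∀ s ∈ Set.Ico (0:ℝ) 1,
      (Hm F x0 ε)^[m + 1] (arc xm a z t) ≠ arc xm a z s := by
  set H := Hm F x0 ε with hH
  set c := arc xm a z with hc
  have ha0 : a < 0 := by linarith
  have hxlt : z.re < xm := by
    have := h.left ⟨xm, 0⟩ le_rfl; rw [hxm] at this; exact this
  have hc0 : c 0 = ⟨xm, a⟩ := by simp [hc, arc]
  have hHc : H (c 0) = z := by
    have hre : (F ⟨xm, a⟩).re = z.re := by rw [bot_re h _ ha0.le]; exact hxm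
    rw [hc0]
    apply Complex.ext
    · simp only [hH, Hm]; exact hre
    · simp only [hH, Hm, hre]
      rw [h.bot _ ha0.le, min_eq_left ha0.le, max_eq_right (by linarith)]
      linarith
  refine ⟨hHc, ?_⟩
  -- not in E1
  have hE : ∀ p : ℂ, 0 ≤ p.im → ε * phi x0 ((H p).re : AddCircle (1:ℝ)) ≤ (H p).im := by
    intro p hp
    simp only [hH, Hm]
    have := h.nonneg p
    have h3 : 0 ≤ max (p.im - 1) 0 := le_max_right _ _
    rw [min_eq_right hp]; linarith
  have claim : ∀ m : ℕ, ∀ t ∈ Set.Ico (0:ℝ) 1,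
      let q := H^[m + 1] (c t)
      ε * phi x0 (q.re : AddCircle (1:ℝ)) ≤ q.im ∨ q.re < z.re ∨ q = z := by
    intro m t ht
    induction m with
    | zero =>
      simp only [zero_add, Function.iterate_one]
      rcases le_or_gt 0 (c t).im with h0 | h0
      · exact Or.inl (hE _ h0)
      · right
        rcases eq_or_lt_of_le ht.1 with he | hlt
        · right; rw [← he]; exact hHc
        · left
          have : (H (c t)).re = (F ⟨(c t).re, 0⟩).re := by
            simp only [hH, Hm]; exact bot_re h _ h0.le
          rw [this, ← hxm]
          apply h.mono
          simp only [hc, arc]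
          have : 0 < min (2 * t) 1 := lt_min (by linarith) one_pos
          nlinarith
    | succ n ih =>
      simp only at ih ⊢
      rw [Function.iterate_succ_apply']
      set q := H^[n + 1] (c t)
      rcases le_or_gt 0 q.im with h0 | h0
      · exact Or.inl (hE _ h0)
      · rcases ih with i | i | i
        · have := mul_nonneg hε.le (phi_nonneg x0 (q.re : AddCircle (1:ℝ))); linarith
        · right; left
          have := h.left q h0.le
          simp only [hH, Hm]; linarith
        · rw [i] at h0; linarith
  intro m t ht s hs he
  have hcl := claim m t ht
  simp only [he] at hcl
  have hmin : 0 ≤ min (2 * s) 1 := le_min (by linarith [hs.1]) zero_le_one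
  have hmin1 : min (2 * s) 1 ≤ 1 := min_le_right _ _
  have hmax1 : max (2 * s - 1) 0 < 1 := max_lt (by linarith [hs.2]) one_pos
  rcases hcl with i | i | i
  · simp only [hc, arc] at i
    rcases le_or_gt (2 * s) 1 with hs2 | hs2
    · rw [max_eq_right (by linarith)] at i
      have := mul_nonneg hε.le (phi_nonneg x0 ((xm + min (2 * s) 1 * (z.re - xm) : ℝ) : AddCircle (1:ℝ)))
      linarith
    · rw [min_eq_right hs2.le] at i
      rw [show xm + 1 * (z.re - xm) = z.re by ring] at i
      nlinarith
  · simp only [hc, arc] at i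
    nlinarith
  · have := congrArg Complex.im i
    simp only [hc, arc] at this
    nlinarith

theorem exists_curve {F : ℂ → ℂ} (h : Str F) (hsurj : ∀ x, ∃ x', (F ⟨x', 0⟩).re = x)
    {x0 ε : ℝ} (hε : 0 < ε) (z : ℂ) (hz0 : 0 < z.im)
    (hz1 : z.im < ε * phi x0 (z.re : AddCircle (1:ℝ))) :
    ∃ C : ℝ → ℂ, (∀ N : ℕ, ContinuousOn C (Set.Icc 0 N)) ∧
      (∀ s, 0 ≤ s → C (s + 1) = Hm F x0 ε (C s)) ∧
      (∀ s t, 0 ≤ s → s + 1 ≤ t → C t ≠ C s) ∧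
      (C 0).im < 0 ∧ (∀ t, 0 ≤ t → (C 0).im ≤ (C t).im) ∧
      (∀ n : ℕ, C (n + 1) = (Hm F x0 ε)^[n] z) ∧
      (∀ t, 0 ≤ t → t < 1 → (C t).im ≤ ε) := by
  obtain ⟨xm, hxm⟩ := hsurj z.re
  set a : ℝ := z.im - ε * phi x0 (z.re : AddCircle (1:ℝ)) with ha
  obtain ⟨hHc, hsep⟩ := sep h hε z hz0 hz1 xm hxm a ha
  have ha0 : a < 0 := by linarith
  set H := Hm F x0 ε with hH
  set c := arc xm a z with hc
  have hc0 : c 0 = ⟨xm, a⟩ := by simp [hc, arc]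
  have hc1 : c 1 = z := by
    apply Complex.ext
    · simp [hc, arc]
    · simp only [hc, arc]; norm_num
  have hcc : Continuous c := arc_cont _ _ _
  have hHcont : Continuous H := Hm_cont h.cont x0 ε
  set C : ℝ → ℂ := fun s => H^[⌊s⌋₊] (c (s - ⌊s⌋₊)) with hC
  have hCn : ∀ (n : ℕ) (s : ℝ), s ∈ Set.Icc (n:ℝ) (n + 1) → C s = H^[n] (c (s - n)) := by
    intro n s hs
    rcases eq_or_lt_of_le hs.2 with he | hlt
    · have hf : ⌊s⌋₊ = n + 1 := by
        rw [he]; exact_mod_cast Nat.floor_natCast (R := ℝ) (n + 1)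
      simp only [hC, hf]
      rw [Function.iterate_succ_apply, he]
      push_cast
      simp [hHc, hc1]
    · have hf : ⌊s⌋₊ = n := by
        rw [Nat.floor_eq_iff (le_trans (Nat.cast_nonneg n) hs.1)]; exact ⟨hs.1, hlt⟩
      simp only [hC, hf]
  have hmono : ∀ p : ℂ, a ≤ p.im → a ≤ (H p).im := by
    intro p hp
    have h1 := h.nonneg p
    have h2 : 0 ≤ max (p.im - 1) 0 := le_max_right _ _
    have h3 := mul_nonneg hε.le (phi_nonneg x0 ((F p).re : AddCircle (1:ℝ)))
    have h4 : a ≤ min p.im 0 := le_min hp ha0.le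
    simp only [hH, Hm]; linarith
  have hfr : ∀ s : ℝ, 0 ≤ s → s - ⌊s⌋₊ ∈ Set.Ico (0:ℝ) 1 := fun s hs =>
    ⟨by linarith [Nat.floor_le hs], by linarith [Nat.lt_floor_add_one s]⟩
  have hC0 : C 0 = ⟨xm, a⟩ := by simp [hC, hc0]
  refine ⟨C, ?_, ?_, ?_, ?_, ?_, ?_, ?_⟩
  · intro N
    induction N with
    | zero => simp
    | succ n ih =>
      have : Set.Icc (0:ℝ) ((n + 1 : ℕ) : ℝ) = Set.Icc 0 (n:ℝ) ∪ Set.Icc (n:ℝ) (n + 1) := by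
        rw [Set.Icc_union_Icc_eq_Icc (Nat.cast_nonneg n) (by linarith)]; push_cast; rfl
      rw [this]
      refine ih.union_of_isClosed ?_ isClosed_Icc isClosed_Icc
      refine ContinuousOn.congr (f := fun s => H^[n] (c (s - n))) ?_ (hCn n)
      apply Continuous.continuousOn
      exact (hHcont.iterate n).comp (by fun_prop)
  · intro s hs
    simp only [hC]
    rw [Nat.floor_add_one hs, Function.iterate_succ_apply']
    push_cast
    rw [add_sub_add_right_eq_sub]
  · intro s t hs hst he
    have ht : 0 ≤ t := by linarith
    have hfl : ⌊s⌋₊ + 1 ≤ ⌊t⌋₊ := by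
      rw [← Nat.floor_add_one hs]; exact Nat.floor_mono hst
    obtain ⟨m, hm⟩ := Nat.exists_eq_add_of_le hfl
    simp only [hC] at he
    rw [hm, show ⌊s⌋₊ + 1 + m = ⌊s⌋₊ + (m + 1) by ring, Function.iterate_add_apply] at he
    have := (Hm_inj h x0 ε).iterate ⌊s⌋₊ he
    have hf := hfr t ht
    rw [hm, show ⌊s⌋₊ + 1 + m = ⌊s⌋₊ + (m + 1) by ring] at hf
    exact hsep m _ hf _ (hfr s hs) this
  · rw [hC0]; exact ha0
  · intro t ht
    rw [hC0]
    have : ∀ n : ℕ, ∀ p : ℂ, a ≤ p.im → a ≤ (H^[n] p).im := by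
      intro n
      induction n with
      | zero => intro p hp; exact hp
      | succ n ih => intro p hp; rw [Function.iterate_succ_apply]; exact ih _ (hmono p hp)
    apply this
    simp only [hc, arc]
    have h2 : 0 ≤ max (2 * (t - ⌊t⌋₊) - 1) 0 := le_max_right _ _
    nlinarith
  · intro n
    rw [hCn n (n + 1) ⟨by linarith, le_rfl⟩]
    simp [hc1]
  · intro t h0 h1
    have hf : ⌊t⌋₊ = 0 := Nat.floor_eq_zero.mpr h1
    simp only [hC, hf, Function.iterate_zero, id]
    simp only [hc, arc, Nat.cast_zero, sub_zero]
    have h2 : 0 ≤ max (2 * t - 1) 0 := le_max_right _ _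
    have h3 : max (2 * t - 1) 0 ≤ 1 := max_le (by linarith) zero_le_one
    have h4 := phi_le x0 (z.re : AddCircle (1:ℝ))
    nlinarith
end PB
end

section
namespace PB

theorem log_cont_upper : ContinuousOn Complex.log {z : ℂ | 0 ≤ z.im ∧ z ≠ 0} := by
  rintro z ⟨h1, h2⟩
  by_cases hz : z ∈ Complex.slitPlane
  · exact (continuousAt_clog hz).continuousWithinAt
  · rw [Complex.mem_slitPlane_iff, not_or, not_lt, not_not] at hz
    have hre : z.re < 0 := by
      rcases lt_or_eq_of_le hz.1 with h | h
      · exact h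
      · exact absurd (Complex.ext h hz.2) h2
    exact (Complex.continuousWithinAt_log_of_re_neg_of_im_zero hre hz.2).mono (fun w hw => hw.1)

/-- The argument of a vector transported along the boundary of the triangle. -/
theorem triangle {C : ℝ → ℂ} {e : ℝ} (he : 1 ≤ e) (hC : ContinuousOn C (Set.Icc 0 e))
    (hne : ∀ s t, 0 ≤ s → s + 1 ≤ t → t ≤ e → C t ≠ C s)
    (hlow : ∀ t, 0 ≤ t → t ≤ e → (C 0).im ≤ (C t).im)
    (hhigh : ∀ t, 0 ≤ t → t ≤ e → (C t).im ≤ (C e).im)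
    (W : ℝ → ℂ) (hW : ContinuousOn W (Set.Icc 0 (e - 1)))
    (hWe : ∀ s ∈ Set.Icc 0 (e - 1), Complex.exp (W s) = C (s + 1) - C s) :
    W (e - 1) - W 0 = Complex.log (C e - C (e - 1)) - Complex.log (C 1 - C 0) := by
  set Q : Set (ℝ × ℝ) := {q | 0 ≤ q.1 ∧ q.1 + 1 ≤ q.2 ∧ q.2 ≤ e} with hQ
  obtain ⟨Λ, hΛ, hΛe, -⟩ := lift_log Q (fun τ q => C (e + τ * (q.2 - e)) - C (τ * q.1))
    (by
      apply ContinuousOn.sub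
      · refine hC.comp (by fun_prop) ?_
        rintro ⟨τ, q⟩ ⟨⟨h1, h2⟩, h3, h4, h5⟩
        dsimp only at *
        constructor <;> nlinarith
      · refine hC.comp (by fun_prop) ?_
        rintro ⟨τ, q⟩ ⟨⟨h1, h2⟩, h3, h4, h5⟩
        dsimp only at *
        constructor <;> nlinarith)
    (by
      rintro τ ⟨h1, h2⟩ q ⟨h3, h4, h5⟩
      apply sub_ne_zero.mpr
      apply hne <;> nlinarith)
    (fun _ => Complex.log (C e - C 0)) continuousOn_const
    (by
      rintro q ⟨h3, h4, h5⟩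
      simp only [zero_mul, add_zero]
      exact Complex.exp_log (sub_ne_zero.mpr (hne _ _ le_rfl (by linarith) le_rfl)))
  have hΛe' : ∀ s t, 0 ≤ s → s + 1 ≤ t → t ≤ e → Complex.exp (Λ (s, t)) = C t - C s := by
    intro s t h1 h2 h3
    have := hΛe (s, t) ⟨h1, h2, h3⟩
    simpa using this
  have e1 : Λ (0, 1) - Complex.log (C 1 - C 0) = Λ (0, e) - Complex.log (C e - C 0) := by
    refine log_unique (L1 := fun t => Λ (0, t)) (L2 := fun t => Complex.log (C t - C 0))
      (s := Set.Icc 1 e) isPreconnected_Icc ?_ ?_ ?_ ⟨le_rfl, he⟩ ⟨he, le_rfl⟩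
    · refine hΛ.comp (by fun_prop) ?_
      rintro t ⟨h1, h2⟩
      exact ⟨le_rfl, by simpa using h1, h2⟩
    · refine log_cont_upper.comp ((hC.mono (Set.Icc_subset_Icc_left zero_le_one)).sub
        continuousOn_const) ?_
      rintro t ⟨h1, h2⟩
      refine ⟨?_, sub_ne_zero.mpr (hne _ _ le_rfl (by linarith) h2)⟩
      have := hlow t (by linarith) h2
      simp; exact this
    · rintro t ⟨h1, h2⟩
      rw [hΛe' _ _ le_rfl (by linarith) h2,
        Complex.exp_log (sub_ne_zero.mpr (hne _ _ le_rfl (by linarith) h2))]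
  have e2 : Λ (0, e) - Complex.log (C e - C 0) = Λ (e - 1, e) - Complex.log (C e - C (e - 1)) := by
    refine log_unique (L1 := fun t => Λ (t, e)) (L2 := fun t => Complex.log (C e - C t))
      (s := Set.Icc 0 (e - 1)) isPreconnected_Icc ?_ ?_ ?_ ⟨le_rfl, by linarith⟩
      ⟨by linarith, le_rfl⟩
    · refine hΛ.comp (by fun_prop) ?_
      rintro t ⟨h1, h2⟩
      exact ⟨h1, by dsimp only; linarith, le_rfl⟩
    · refine log_cont_upper.comp (continuousOn_const.sub
        (hC.mono (Set.Icc_subset_Icc_right (by linarith)))) ?_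
      rintro t ⟨h1, h2⟩
      refine ⟨?_, sub_ne_zero.mpr (hne _ _ h1 (by linarith) le_rfl)⟩
      have := hhigh t h1 (by linarith)
      simp; exact this
    · rintro t ⟨h1, h2⟩
      rw [hΛe' _ _ h1 (by linarith) le_rfl,
        Complex.exp_log (sub_ne_zero.mpr (hne _ _ h1 (by linarith) le_rfl))]
  have e3 : Λ (0, 0 + 1) - W 0 = Λ (e - 1, e - 1 + 1) - W (e - 1) := by
    refine log_unique (L1 := fun t => Λ (t, t + 1)) (L2 := W)
      (s := Set.Icc 0 (e - 1)) isPreconnected_Icc ?_ hW ?_ ⟨le_rfl, by linarith⟩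
      ⟨by linarith, le_rfl⟩
    · refine hΛ.comp (by fun_prop) ?_
      rintro t ⟨h1, h2⟩
      exact ⟨h1, le_rfl, by dsimp only; linarith⟩
    · rintro t ⟨h1, h2⟩
      rw [hΛe' _ _ h1 le_rfl (by linarith), hWe t ⟨h1, h2⟩]
  rw [zero_add, sub_add_cancel] at e3
  linear_combination e3 - e1 - e2

theorem arg_start {u : ℂ} (hu : 0 < u.re) (hi : u.im ≤ 0) : (-u).arg = u.arg + Real.pi := by
  rcases lt_or_eq_of_le hi with h | h
  · exact Complex.arg_neg_eq_arg_add_pi_of_im_neg h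
  · have : u = ((u.re : ℝ) : ℂ) := Complex.ext rfl (by simpa using h)
    rw [this, Complex.arg_ofReal_of_nonneg hu.le, ← Complex.ofReal_neg,
      Complex.arg_ofReal_of_neg (by simpa using hu)]
    simp

theorem Hm_im_le {F : ℂ → ℂ} (h : Str F) {x0 ε : ℝ} (hε : 0 < ε) {p : ℂ} (hp : p.im ≤ 1) :
    (Hm F x0 ε p).im ≤ 1 + ε := by
  have h1 := h.le_one p
  have h2 := phi_le x0 ((F p).re : AddCircle (1:ℝ))
  have h3 : min p.im 0 ≤ 0 := min_le_right _ _
  have h4 : max (p.im - 1) 0 = 0 := max_eq_right (by linarith)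
  simp only [Hm, h4]
  nlinarith

theorem Hm_grow {F : ℂ → ℂ} (h : Str F) {x0 ε : ℝ} (hε : 0 < ε) {z : ℂ} (hz : 1 < z.im) :
    ∃ n : ℕ, 1 + ε < ((Hm F x0 ε)^[n] z).im := by
  have key : ∀ n : ℕ, 1 + (n:ℝ) * (z.im - 1) + (z.im - 1) ≤ ((Hm F x0 ε)^[n] z).im := by
    intro n
    induction n with
    | zero => simp
    | succ n ih =>
      rw [Function.iterate_succ_apply']
      set p := (Hm F x0 ε)^[n] z
      have hn : 0 ≤ (n:ℝ) * (z.im - 1) := mul_nonneg (Nat.cast_nonneg n) (by linarith)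
      have hp : 1 ≤ p.im := by linarith
      have h1 := h.top p hp
      have h2 := mul_nonneg hε.le (phi_nonneg x0 ((F p).re : AddCircle (1:ℝ)))
      simp only [Hm, h1]
      rw [min_eq_right (by linarith), max_eq_left (by linarith)]
      push_cast
      linarith
  obtain ⟨n, hn⟩ := exists_nat_gt (ε / (z.im - 1))
  refine ⟨n, lt_of_lt_of_le ?_ (key n)⟩
  rw [div_lt_iff₀ (by linarith)] at hn
  linarith

theorem core {F : ℂ → ℂ} (h : Str F) (hsurj : ∀ x, ∃ x', (F ⟨x', 0⟩).re = x) (x0 : ℝ)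
    (hfix : ∀ p, F p = p → ∃ j : ℤ, p.re = x0 + j)
    (hesc : ∀ ε > 0, ∃ (z : ℂ) (N : ℕ), 0 < z.im ∧
      z.im < ε * phi x0 ((z.re : ℝ) : AddCircle (1:ℝ)) ∧ 1 < ((Hm F x0 ε)^[N] z).im)
    (L : ℂ → ℂ) (hLc : ContinuousOn L {p | 0 ≤ p.im ∧ p.im ≤ 1 ∧ F p ≠ p})
    (hLe : ∀ p, 0 ≤ p.im → p.im ≤ 1 → F p ≠ p → Complex.exp (L p) = F p - p) :
    ∃ p q : ℂ, p.im = 1 ∧ q.im = 0 ∧ (L p).im - (L q).im = -Real.pi := by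
  obtain ⟨ε, hε, heps⟩ := exists_eps h x0 hfix
  obtain ⟨z, N, hz0, hz1, hN⟩ := hesc ε hε
  obtain ⟨C, hCc, hCH, hCne, hC0, hClow, hCz, hCε⟩ := exists_curve h hsurj hε z hz0 hz1
  obtain ⟨n, hn⟩ := Hm_grow (x0 := x0) h hε hN
  rw [← Function.iterate_add_apply, ← hCz] at hn
  set M : ℕ := n + N + 1 with hM
  obtain ⟨e, ⟨he0, heM⟩, hemax⟩ := isCompact_Icc.exists_isMaxOn (s := Set.Icc (0:ℝ) M)
    (f := fun t => (C t).im) ⟨0, by simp⟩ (Complex.continuous_im.comp_continuousOn (hCc M))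
  have heim : 1 + ε < (C e).im := by
    refine lt_of_lt_of_le hn ?_
    have := hemax (a := ((n + N : ℕ) : ℝ) + 1) ⟨by positivity, by rw [hM]; push_cast; rfl⟩
    exact this
  have he1 : 1 ≤ e := by
    by_contra hlt
    have := hCε e he0 (by linarith)
    linarith
  have hCH' : ∀ s, 0 ≤ s → C (s + 1) = Hm F x0 ε (C s) := hCH
  have hep : 1 < (C (e - 1)).im := by
    by_contra hle
    have := Hm_im_le (x0 := x0) h hε (not_lt.mp hle)
    rw [← hCH' _ (by linarith), sub_add_cancel] at this
    linarith
  have hC' : ContinuousOn C (Set.Icc 0 e) := (hCc M).mono (Set.Icc_subset_Icc_right heM)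
  have hv : ∀ s, 0 ≤ s → F (cl (C s)) ≠ cl (C s) := by
    intro s hs hfx
    have hcm := cl_mem (C s)
    have h0 : 0 < (cl (C s)).im := by
      by_contra hcon
      have := h.left _ (not_lt.mp hcon)
      rw [hfx] at this; exact lt_irrefl _ this
    have h1 : (cl (C s)).im < 1 := by
      by_contra hcon
      have := h.right _ (not_lt.mp hcon)
      rw [hfx] at this; exact lt_irrefl _ this
    have hc : cl (C s) = C s := by
      have h0' : 0 < max 0 (min (C s).im 1) := h0
      have h1' : max 0 (min (C s).im 1) < 1 := h1
      rw [max_lt_iff] at h1'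
      rw [lt_max_iff] at h0'
      have h2 : (C s).im < 1 := by
        rcases min_lt_iff.mp h1'.2 with h | h
        · exact h
        · exact absurd h (lt_irrefl _)
      have h3 : 0 < (C s).im := by
        rcases h0' with h | h
        · exact absurd h (lt_irrefl _)
        · exact (lt_min_iff.mp h).1
      apply Complex.ext
      · rfl
      · show max 0 (min (C s).im 1) = (C s).im
        rw [min_eq_left h2.le, max_eq_right h3.le]
    rw [hc] at hfx h0 h1
    obtain ⟨j, hj⟩ := hfix _ hfx
    apply hCne s (s + 1) hs le_rfl
    rw [hCH' s hs]
    apply Complex.ext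
    · simp [Hm, hfx]
    · have hp0 : phi x0 (((C s).re : ℝ) : AddCircle (1:ℝ)) = 0 := by
        rw [hj, coe_add_int]; simp [phi]
      simp only [Hm, hfx, hp0]
      rw [min_eq_right h0.le, max_eq_right (by linarith)]
      ring
  set U : ℝ → ℂ := fun s => (C (s + 1) - C s) / (F (cl (C s)) - cl (C s)) with hU
  have hUpos : ∀ s, 0 ≤ s → 0 < (U s).re := by
    intro s hs
    simp only [hU]
    rw [hCH' s hs]
    exact ratio_pos h hε heps _ (hv s hs)
  have hclc : ContinuousOn (fun s => cl (C s)) (Set.Icc 0 (e - 1)) :=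
    cl_cont.comp_continuousOn (hC'.mono (Set.Icc_subset_Icc_right (by linarith)))
  have tri := triangle he1 hC' (fun s t h1 h2 _ => hCne s t h1 h2) (fun t h1 _ => hClow t h1)
    (fun t h1 h2 => hemax ⟨h1, h2.trans heM⟩) (fun s => L (cl (C s)) + Complex.log (U s))
    (by
      apply ContinuousOn.add
      · refine hLc.comp hclc ?_
        rintro s ⟨h1, h2⟩
        exact ⟨(cl_mem _).1, (cl_mem _).2, hv s h1⟩
      · apply ContinuousOn.clog
        · apply ContinuousOn.div
          · apply ContinuousOn.sub
            · refine hC'.comp (by fun_prop) ?_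
              rintro s ⟨h1, h2⟩
              constructor <;> linarith
            · exact hC'.mono (Set.Icc_subset_Icc_right (by linarith))
          · exact (h.cont.comp_continuousOn hclc).sub hclc
          · rintro s ⟨h1, h2⟩
            exact sub_ne_zero.mpr (hv s h1)
        · rintro s ⟨h1, h2⟩
          exact Or.inl (hUpos s h1))
    (by
      rintro s ⟨h1, h2⟩
      rw [Complex.exp_add, hLe _ (cl_mem _).1 (cl_mem _).2 (hv s h1), Complex.exp_log,
        mul_div_cancel₀ _ (sub_ne_zero.mpr (hv s h1))]
      intro h0
      have := hUpos s h1
      rw [h0] at this; simp at this)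
  refine ⟨cl (C (e - 1)), cl (C 0), ?_, ?_, ?_⟩
  · simp [cl, min_eq_right hep.le]
  · simp only [cl]; rw [max_eq_left ((min_le_left _ _).trans hC0.le)]
  have hi := congrArg Complex.im tri
  simp only [Complex.sub_im, Complex.add_im, Complex.log_im] at hi
  have hstart : (C 1 - C 0).arg = (U 0).arg + Real.pi := by
    have hc0 : (cl (C 0)).im = 0 := by
      simp only [cl]; rw [max_eq_left ((min_le_left _ _).trans hC0.le)]
    set v := F (cl (C 0)) - cl (C 0) with hvd
    have hvre : v.re < 0 := by
      have := h.left _ hc0.le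
      simp [hvd]; exact this
    have hvim : v.im = 0 := by
      have := h.bot _ hc0.le
      simp [hvd, this, hc0]
    have hvr : v = ((v.re : ℝ) : ℂ) := Complex.ext rfl (by simpa using hvim)
    have hw : C 1 - C 0 = ((-v.re : ℝ) : ℂ) * (-(U 0)) := by
      simp only [hU, zero_add]
      rw [← hvd, Complex.ofReal_neg, ← hvr]
      have : v ≠ 0 := sub_ne_zero.mpr (hv 0 le_rfl)
      field_simp
    rw [hw, Complex.arg_real_mul _ (by linarith)]
    apply arg_start (hUpos 0 le_rfl)
    have hwi : 0 ≤ (C 1 - C 0).im := by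
      have := hClow 1 zero_le_one
      simp; exact this
    rw [hw, Complex.im_ofReal_mul] at hwi
    simp at hwi
    nlinarith
  have hend : (C e - C (e - 1)).arg = (U (e - 1)).arg := by
    have hc0 : (cl (C (e - 1))).im = 1 := by simp [cl, min_eq_right hep.le]
    set v := F (cl (C (e - 1))) - cl (C (e - 1)) with hvd
    have hvre : 0 < v.re := by
      have := h.right _ hc0.ge
      simp [hvd]; exact this
    have hvim : v.im = 0 := by
      have := h.top _ hc0.ge
      simp [hvd, this, hc0]
    have hvr : v = ((v.re : ℝ) : ℂ) := Complex.ext rfl (by simpa using hvim)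
    have hw : C e - C (e - 1) = ((v.re : ℝ) : ℂ) * (U (e - 1)) := by
      simp only [hU, sub_add_cancel]
      rw [← hvd, ← hvr]
      have : v ≠ 0 := sub_ne_zero.mpr (hv _ (by linarith))
      field_simp
    rw [hw, Complex.arg_real_mul _ hvre]
  linarith
end PB
end

section
namespace PB

/-- The annulus data: an area preserving homeomorphism with a lift. -/
structure Bd (f : (AddCircle (1:ℝ) × (Set.Icc (0:ℝ) 1)) ≃ₜ (AddCircle (1:ℝ) × (Set.Icc (0:ℝ) 1)))
    (F : ℝ × (Set.Icc (0:ℝ) 1) → ℝ × (Set.Icc (0:ℝ) 1)) : Prop where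
  mp : MeasurePreserving f volume volume
  b0 : ∀ a, (f (a, 0)).2 = 0
  b0s : ∀ a, ∃ b, f (b, 0) = (a, 0)
  b1 : ∀ a, (f (a, 1)).2 = 1
  b1s : ∀ a, ∃ b, f (b, 1) = (a, 1)
  cont : Continuous F
  lift : ∀ x y, (((F (x, y)).1 : AddCircle (1:ℝ)), (F (x, y)).2) = f ((x : AddCircle (1:ℝ)), y)
  per : ∀ x y, F (x + 1, y) = ((F (x, y)).1 + 1, (F (x, y)).2)

variable {f : (AddCircle (1:ℝ) × (Set.Icc (0:ℝ) 1)) ≃ₜ (AddCircle (1:ℝ) × (Set.Icc (0:ℝ) 1))}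
    {F : ℝ × (Set.Icc (0:ℝ) 1) → ℝ × (Set.Icc (0:ℝ) 1)}

theorem Bd.per_int (h : Bd f F) (x y) (j : ℤ) :
    F (x + j, y) = ((F (x, y)).1 + j, (F (x, y)).2) := by
  induction j using Int.induction_on with
  | zero => simp
  | succ i ih => 
    push_cast at ih ⊢
    rw [← add_assoc, h.per, ih, add_assoc]
  | pred i ih =>
    push_cast at ih ⊢
    have := h.per (x + (-(i:ℝ) - 1)) y
    rw [show x + (-(i:ℝ) - 1) + 1 = x + -(i:ℝ) by ring, ih] at this
    have h1 := congrArg Prod.fst this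
    have h2 := congrArg Prod.snd this
    simp only at h1 h2
    exact Prod.ext (by simp only; linarith) h2.symm

theorem coe_eq_iff (x x' : ℝ) (h : (x : AddCircle (1:ℝ)) = (x' : AddCircle (1:ℝ))) :
    ∃ j : ℤ, x = x' + j := by
  have : ((x - x' : ℝ) : AddCircle (1:ℝ)) = 0 := by rw [AddCircle.coe_sub, h, sub_self]
  rw [AddCircle.coe_eq_zero_iff] at this
  obtain ⟨j, hj⟩ := this
  exact ⟨j, by simp at hj; linarith⟩

theorem Bd.inj (h : Bd f F) : Function.Injective F := by
  rintro ⟨x, y⟩ ⟨x', y'⟩ he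
  have : f (x, y) = f (x', y') := by rw [← h.lift, ← h.lift, he]
  have := f.injective this
  rw [Prod.mk.injEq] at this
  obtain ⟨j, hj⟩ := coe_eq_iff _ _ this.1
  obtain rfl := this.2
  subst hj
  rw [h.per_int] at he
  have := congrArg Prod.fst he
  simp at this
  simp [this]

noncomputable def cx (q : ℝ × (Set.Icc (0:ℝ) 1)) : ℂ := ⟨q.1, q.2⟩

noncomputable def Fh (F : ℝ × (Set.Icc (0:ℝ) 1) → ℝ × (Set.Icc (0:ℝ) 1)) (p : ℂ) : ℂ :=
  cx (F (p.re, Set.projIcc 0 1 zero_le_one p.im))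

theorem cx_cont : Continuous cx := by
  have e : cx = fun q => ((q.1 : ℝ) : ℂ) + (((q.2 : ℝ)) : ℂ) * Complex.I := by
    ext p; apply Complex.ext <;> simp [cx]
  rw [e]; fun_prop

theorem cx_inj : Function.Injective cx := by
  rintro ⟨x, y⟩ ⟨x', y'⟩ he
  have h1 := congrArg Complex.re he
  have h2 := congrArg Complex.im he
  simp only [cx] at h1 h2
  exact Prod.ext h1 (Subtype.ext h2)

theorem Bd.mono_b (h : Bd f F) (c : Set.Icc (0:ℝ) 1) (hc : ∀ x, (F (x, c)).2 = c) :
    StrictMono fun x => (F (x, c)).1 := by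
  have hc1 : Continuous fun x => (F (x, c)).1 := by
    have := h.cont; fun_prop
  have hi : Function.Injective fun x => (F (x, c)).1 := by
    intro x x' he
    have : F (x, c) = F (x', c) := Prod.ext he (by rw [hc, hc])
    exact congrArg Prod.fst (h.inj this)
  rcases hc1.strictMono_of_inj hi with hm | hm
  · exact hm
  · have := hm (show (0:ℝ) < 0 + 1 by norm_num)
    simp only [h.per] at this
    linarith

theorem Bd.F0 (h : Bd f F) (x : ℝ) : (F (x, 0)).2 = 0 := by
  have := congrArg Prod.snd (h.lift x 0)
  simp only [h.b0] at this; exact this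

theorem Bd.F1 (h : Bd f F) (x : ℝ) : (F (x, 1)).2 = 1 := by
  have := congrArg Prod.snd (h.lift x 1)
  simp only [h.b1] at this; exact this

theorem proj_bot {y : ℝ} (h : y ≤ 0) : Set.projIcc (0:ℝ) 1 zero_le_one y = 0 :=
  Set.projIcc_of_le_left _ h

theorem proj_top {y : ℝ} (h : 1 ≤ y) : Set.projIcc (0:ℝ) 1 zero_le_one y = 1 :=
  Set.projIcc_of_right_le _ h

theorem Bd.str (h : Bd f F) (hl : ∀ x, (F (x, 0)).1 < x) (hr : ∀ x, x < (F (x, 1)).1) :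
    Str (Fh F) where
  cont := by
    unfold Fh
    exact cx_cont.comp (h.cont.comp (Complex.continuous_re.prodMk
      (continuous_projIcc.comp Complex.continuous_im)))
  nonneg p := (F _).2.2.1
  le_one p := (F _).2.2.2
  bot p hp := by simp [Fh, cx, proj_bot hp, h.F0]
  top p hp := by simp [Fh, cx, proj_top hp, h.F1]
  clampBot x y hy := by simp only [Fh, proj_bot hy, proj_bot le_rfl]
  clampTop x y hy := by simp only [Fh, proj_top hy, proj_top le_rfl]
  inj p q h1 h2 h3 h4 he := by
    have := h.inj (cx_inj he)
    rw [Prod.mk.injEq, Set.projIcc_of_mem _ ⟨h1, h2⟩, Set.projIcc_of_mem _ ⟨h3, h4⟩] at this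
    exact Complex.ext this.1 (congrArg Subtype.val this.2)
  per p := by
    simp only [Fh, Complex.add_re, Complex.one_re, Complex.add_im, Complex.one_im, add_zero, h.per]
    apply Complex.ext <;> simp [cx]
  left p hp := by simpa [Fh, cx, proj_bot hp] using hl p.re
  right p hp := by simpa [Fh, cx, proj_top hp] using hr p.re
  mono x x' hx := by
    simp only [Fh, cx, proj_bot le_rfl]
    exact h.mono_b 0 h.F0 hx

theorem Bd.surj (h : Bd f F) (x : ℝ) : ∃ x', (Fh F ⟨x', 0⟩).re = x := by
  obtain ⟨b, hb⟩ := h.b0s x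
  obtain ⟨x', rfl⟩ := QuotientAddGroup.mk_surjective b
  have := congrArg Prod.fst ((h.lift x' 0).trans hb)
  obtain ⟨j, hj⟩ := coe_eq_iff _ _ this
  refine ⟨x' + ((-j : ℤ) : ℝ), ?_⟩
  simp only [Fh, cx, proj_bot le_rfl, h.per_int, hj]
  push_cast; ring

theorem Bd.fixed (h : Bd f F) {p : ℂ} (hp : Fh F p = p) :
    ∃ y : Set.Icc (0:ℝ) 1, (y : ℝ) = p.im ∧ f (((p.re : ℝ) : AddCircle (1:ℝ)), y) = (((p.re : ℝ) : AddCircle (1:ℝ)), y) := by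
  have hm : p.im ∈ Set.Icc (0:ℝ) 1 := by
    rw [← hp]; exact (F _).2.2
  refine ⟨⟨p.im, hm⟩, rfl, ?_⟩
  rw [← h.lift]
  have : F (p.re, ⟨p.im, hm⟩) = (p.re, ⟨p.im, hm⟩) := by
    apply cx_inj
    rw [show cx (p.re, ⟨p.im, hm⟩) = p from rfl]
    conv_rhs => rw [← hp]
    rw [Fh, Set.projIcc_of_mem _ hm]
  rw [this]

end PB
end

section
namespace PB

def iot (q : AddCircle (1:ℝ) × (Set.Icc (0:ℝ) 1)) : AddCircle (1:ℝ) × ℝ := (q.1, q.2)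

noncomputable def Tm (x0 ε : ℝ) (m : AddCircle (1:ℝ) × ℝ) : AddCircle (1:ℝ) × ℝ :=
  (m.1, m.2 + ε * phi x0 m.1)

theorem Tm_cont (x0 ε : ℝ) : Continuous (Tm x0 ε) := by
  have := phi_cont x0
  unfold Tm; fun_prop

theorem Tm_inj (x0 ε : ℝ) : Function.Injective (Tm x0 ε) := by
  rintro ⟨a, b⟩ ⟨a', b'⟩ h
  simp only [Tm, Prod.mk.injEq] at h
  obtain ⟨rfl, h2⟩ := h
  simpa using h2

theorem Tm_mp (x0 ε : ℝ) : MeasurePreserving (Tm x0 ε) volume volume := by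
  refine (MeasurePreserving.id (volume : Measure (AddCircle (1:ℝ)))).skew_product
    (g := fun a y => y + ε * phi x0 a) ?_ ?_
  · exact ((continuous_snd).add (continuous_const.mul
      ((phi_cont x0).comp continuous_fst))).measurable
  · exact Eventually.of_forall fun a => (measurePreserving_add_right volume _).map_eq

theorem iot_mp : MeasurePreserving iot volume
    ((volume : Measure (AddCircle (1:ℝ) × ℝ)).restrict (Set.univ ×ˢ Set.Icc (0:ℝ) 1)) := by
  have h0 : MeasurePreserving (Subtype.val : Set.Icc (0:ℝ) 1 → ℝ) volume
      (volume.restrict (Set.Icc (0:ℝ) 1)) := measurePreserving_subtype_coe measurableSet_Icc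
  have h1 := (MeasurePreserving.id (volume : Measure (AddCircle (1:ℝ)))).prod h0
  rw [Measure.volume_eq_prod (AddCircle (1:ℝ)) ℝ, ← Measure.prod_restrict, Measure.restrict_univ]
  exact h1

/-- the successive images of the sheared region -/
noncomputable def Wn
    (f : (AddCircle (1:ℝ) × (Set.Icc (0:ℝ) 1)) ≃ₜ (AddCircle (1:ℝ) × (Set.Icc (0:ℝ) 1)))
    (x0 ε : ℝ) : ℕ → Set (AddCircle (1:ℝ) × ℝ)
  | 0 => {m | 0 < m.2 ∧ m.2 < ε * phi x0 m.1}
  | n + 1 => (fun x => Tm x0 ε (iot (f x))) '' (iot ⁻¹' (Wn f x0 ε n))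

theorem Bd.escape {f : (AddCircle (1:ℝ) × (Set.Icc (0:ℝ) 1)) ≃ₜ (AddCircle (1:ℝ) × (Set.Icc (0:ℝ) 1))}
    {F : ℝ × (Set.Icc (0:ℝ) 1) → ℝ × (Set.Icc (0:ℝ) 1)} (h : Bd f F) (x0 ε : ℝ) (hε : 0 < ε) :
    ∃ (z : ℂ) (N : ℕ), 0 < z.im ∧
      z.im < ε * phi x0 ((z.re : ℝ) : AddCircle (1:ℝ)) ∧ 1 < ((Hm (Fh F) x0 ε)^[N] z).im := by
  by_contra hcon
  push Not at hcon
  set K : AddCircle (1:ℝ) × (Set.Icc (0:ℝ) 1) → AddCircle (1:ℝ) × ℝ :=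
    fun x => Tm x0 ε (iot (f x)) with hK
  have hiot : Continuous iot := by unfold iot; fun_prop
  have hiotinj : Function.Injective iot := by
    rintro ⟨a, b⟩ ⟨a', b'⟩ he
    simp only [iot, Prod.mk.injEq] at he
    exact Prod.ext he.1 (Subtype.ext he.2)
  have hKc : Continuous K := (Tm_cont x0 ε).comp (hiot.comp f.continuous)
  have hKi : Function.Injective K := (Tm_inj x0 ε).comp (hiotinj.comp f.injective)
  have hKe : MeasurableEmbedding K := (hKc.isClosedEmbedding hKi).measurableEmbedding
  have hopen : IsOpen (Wn f x0 ε 0) := by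
    simp only [Wn]
    have := phi_cont x0
    exact (isOpen_lt continuous_const continuous_snd).inter
      (isOpen_lt continuous_snd (by fun_prop))
  have hmeas : ∀ n, MeasurableSet (Wn f x0 ε n) := by
    intro n
    induction n with
    | zero => exact hopen.measurableSet
    | succ n ih => exact hKe.measurableSet_image.mpr (hiot.measurable ih)
  have horb : ∀ n, ∀ m ∈ Wn f x0 ε n, ∃ z : ℂ, 0 < z.im ∧
      z.im < ε * phi x0 ((z.re : ℝ) : AddCircle (1:ℝ)) ∧
      m = (((((Hm (Fh F) x0 ε)^[n] z).re : ℝ) : AddCircle (1:ℝ)), ((Hm (Fh F) x0 ε)^[n] z).im) := by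
    intro n
    induction n with
    | zero =>
      rintro ⟨a, y⟩ ⟨h1, h2⟩
      obtain ⟨x, rfl⟩ := QuotientAddGroup.mk_surjective a
      exact ⟨⟨x, y⟩, h1, h2, rfl⟩
    | succ n ih =>
      rintro m ⟨⟨a, y⟩, hx, rfl⟩
      obtain ⟨z, h1, h2, h3⟩ := ih _ hx
      refine ⟨z, h1, h2, ?_⟩
      rw [Function.iterate_succ_apply']
      set p := (Hm (Fh F) x0 ε)^[n] z
      simp only [iot, Prod.mk.injEq] at h3
      obtain ⟨rfl, hy⟩ := h3
      beta_reduce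
      rw [← h.lift]
      have hp : Set.projIcc (0:ℝ) 1 zero_le_one p.im = y := by
        rw [← hy, Set.projIcc_val]
      have hF : Fh F p = cx (F (p.re, y)) := by rw [Fh, hp]
      have h0 : min p.im 0 = 0 := min_eq_right (by rw [← hy]; exact y.2.1)
      have h1 : max (p.im - 1) 0 = 0 := max_eq_right (by rw [← hy]; linarith [y.2.2])
      simp only [Tm, iot, Hm, hF, h0, h1, cx]
      simp
  have hWsub : ∀ n, Wn f x0 ε n ⊆ Set.univ ×ˢ Set.Icc (0:ℝ) 1 := by
    intro n m hm
    refine ⟨trivial, ?_, ?_⟩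
    · cases n with
      | zero => exact hm.1.le
      | succ n =>
        obtain ⟨x, -, rfl⟩ := hm
        simp only [Tm, iot]
        have := mul_nonneg hε.le (phi_nonneg x0 (f x).1)
        have h2 := (f x).2.2.1
        linarith
    · obtain ⟨z, h1, h2, h3⟩ := horb n m hm
      rw [h3]; exact hcon z n h1 h2
  set W := ⋃ n, Wn f x0 ε n with hW
  have hWm : MeasurableSet W := MeasurableSet.iUnion hmeas
  have hWs : W ⊆ Set.univ ×ˢ Set.Icc (0:ℝ) 1 := Set.iUnion_subset hWsub
  have hKsub : iot ⁻¹' W ⊆ K ⁻¹' (W \ Wn f x0 ε 0) := by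
    intro x hx
    simp only [hW, Set.mem_preimage, Set.mem_iUnion] at hx
    obtain ⟨n, hn⟩ := hx
    refine ⟨Set.mem_iUnion.mpr ⟨n + 1, x, hn, rfl⟩, fun h0 => ?_⟩
    have h1 : (K x).2 < ε * phi x0 (K x).1 := h0.2
    simp only [hK, Tm, iot] at h1
    have h2 := (f x).2.2.1
    linarith
  have hdm : MeasurableSet (W \ Wn f x0 ε 0) := hWm.diff (hmeas 0)
  have e1 : volume (iot ⁻¹' W) = volume W := by
    rw [iot_mp.measure_preimage hWm.nullMeasurableSet, Measure.restrict_eq_self _ hWs]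
  have e2 : volume (K ⁻¹' (W \ Wn f x0 ε 0)) ≤ volume (W \ Wn f x0 ε 0) := by
    have hT := (Tm_cont x0 ε).measurable hdm
    have : K ⁻¹' (W \ Wn f x0 ε 0) = f ⁻¹' (iot ⁻¹' (Tm x0 ε ⁻¹' (W \ Wn f x0 ε 0))) := rfl
    rw [this, h.mp.measure_preimage (hiot.measurable hT).nullMeasurableSet,
      iot_mp.measure_preimage hT.nullMeasurableSet,
      ← (Tm_mp x0 ε).measure_preimage hdm.nullMeasurableSet]
    exact Measure.restrict_apply_le _ _
  have e3 : volume W ≤ volume (W \ Wn f x0 ε 0) := e1 ▸ (measure_mono hKsub).trans e2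
  have hsub0 : Wn f x0 ε 0 ⊆ W := Set.subset_iUnion (Wn f x0 ε) 0
  have hpos : 0 < volume (Wn f x0 ε 0) := by
    refine hopen.measure_pos _ ?_
    have hph : 0 < phi x0 ((x0 + 1/2 : ℝ) : AddCircle (1:ℝ)) := by
      rw [phi, AddCircle.coe_add, add_sub_cancel_left]
      have := AddCircle.norm_half_period_eq (1:ℝ)
      rw [this]; norm_num
    refine ⟨(((x0 + 1/2 : ℝ) : AddCircle (1:ℝ)),
      ε * phi x0 ((x0 + 1/2 : ℝ) : AddCircle (1:ℝ)) / 2), ?_, ?_⟩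
    · have := mul_pos hε hph
      simp only; linarith
    · have := mul_pos hε hph
      simp only; linarith
  have hfin : volume W < ⊤ := by
    refine lt_of_le_of_lt (measure_mono hWs) ?_
    rw [Measure.volume_eq_prod, Measure.prod_prod]
    simp
  have e4 := measure_sdiff_add_inter (μ := volume) W (hmeas 0)
  rw [Set.inter_eq_right.mpr hsub0] at e4
  have hfin2 : volume (W \ Wn f x0 ε 0) ≠ ⊤ :=
    (lt_of_le_of_lt (measure_mono Set.sdiff_subset) hfin).ne
  have := ENNReal.lt_add_right hfin2 hpos.ne'
  rw [e4] at this
  exact absurd e3 (not_le.mpr this)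
end PB
end

section
namespace PB

variable {f : (AddCircle (1:ℝ) × (Set.Icc (0:ℝ) 1)) ≃ₜ (AddCircle (1:ℝ) × (Set.Icc (0:ℝ) 1))}
    {F : ℝ × (Set.Icc (0:ℝ) 1) → ℝ × (Set.Icc (0:ℝ) 1)}

/-- reflection of the annulus -/
def refl2 (τ : Set.Icc (0:ℝ) 1 ≃ₜ Set.Icc (0:ℝ) 1) :
    (AddCircle (1:ℝ) × (Set.Icc (0:ℝ) 1)) ≃ₜ (AddCircle (1:ℝ) × (Set.Icc (0:ℝ) 1)) :=
  (Homeomorph.neg (AddCircle (1:ℝ))).prodCongr τ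

theorem refl2_apply (τ : Set.Icc (0:ℝ) 1 ≃ₜ Set.Icc (0:ℝ) 1) (a y) :
    refl2 τ (a, y) = (-a, τ y) := rfl

def cf (τ : Set.Icc (0:ℝ) 1 ≃ₜ Set.Icc (0:ℝ) 1)
    (f : (AddCircle (1:ℝ) × (Set.Icc (0:ℝ) 1)) ≃ₜ (AddCircle (1:ℝ) × (Set.Icc (0:ℝ) 1))) :=
  (refl2 τ).trans (f.trans (refl2 τ))

theorem cf_apply (τ : Set.Icc (0:ℝ) 1 ≃ₜ Set.Icc (0:ℝ) 1) (a y) :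
    cf τ f (a, y) = (-(f (-a, τ y)).1, τ (f (-a, τ y)).2) := rfl

def cF (τ : Set.Icc (0:ℝ) 1 ≃ₜ Set.Icc (0:ℝ) 1)
    (F : ℝ × (Set.Icc (0:ℝ) 1) → ℝ × (Set.Icc (0:ℝ) 1)) (q : ℝ × (Set.Icc (0:ℝ) 1)) :
    ℝ × (Set.Icc (0:ℝ) 1) :=
  (-(F (-q.1, τ q.2)).1, τ (F (-q.1, τ q.2)).2)

theorem Bd.conj (h : Bd f F) (τ : Set.Icc (0:ℝ) 1 ≃ₜ Set.Icc (0:ℝ) 1)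
    (hmp : MeasurePreserving τ volume volume)
    (hτ : (τ 0 = 0 ∧ τ 1 = 1) ∨ (τ 0 = 1 ∧ τ 1 = 0)) : Bd (cf τ f) (cF τ F) where
  mp := by
    have hr : MeasurePreserving (refl2 τ) volume volume :=
      (Measure.measurePreserving_neg (volume : Measure (AddCircle (1:ℝ)))).prod hmp
    exact hr.comp (h.mp.comp hr)
  b0 a := by
    rw [cf_apply]
    rcases hτ with ⟨h0, h1⟩ | ⟨h0, h1⟩
    · simp only [h0, h.b0]
    · simp only [h0, h1, h.b1]
  b1 a := by
    rw [cf_apply]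
    rcases hτ with ⟨h0, h1⟩ | ⟨h0, h1⟩
    · simp only [h1, h.b1]
    · simp only [h0, h1, h.b0]
  b0s a := by
    rcases hτ with ⟨h0, h1⟩ | ⟨h0, h1⟩
    · obtain ⟨b, hb⟩ := h.b0s (-a)
      exact ⟨-b, by rw [cf_apply, neg_neg, h0, hb]; simp [h0]⟩
    · obtain ⟨b, hb⟩ := h.b1s (-a)
      exact ⟨-b, by rw [cf_apply, neg_neg, h0, hb]; simp [h1]⟩
  b1s a := by
    rcases hτ with ⟨h0, h1⟩ | ⟨h0, h1⟩
    · obtain ⟨b, hb⟩ := h.b1s (-a)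
      exact ⟨-b, by rw [cf_apply, neg_neg, h1, hb]; simp [h1]⟩
    · obtain ⟨b, hb⟩ := h.b0s (-a)
      exact ⟨-b, by rw [cf_apply, neg_neg, h1, hb]; simp [h0]⟩
  cont := by
    have h1 := h.cont
    have h2 := τ.continuous
    unfold cF; fun_prop
  lift x y := by
    rw [cf_apply, ← AddCircle.coe_neg, ← h.lift]
    simp [cF]
  per x y := by
    have := h.per (-x + (-1)) (τ y)
    rw [neg_add_cancel_right] at this
    simp only [cF]
    rw [neg_add, this]
    simp

theorem Fh_conj (p : ℂ) : Fh (cF unitInterval.symmHomeomorph F) p =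
    Complex.I - Fh F (Complex.I - p) := by
  have hp : Set.projIcc (0:ℝ) 1 zero_le_one (Complex.I - p).im =
      unitInterval.symmHomeomorph (Set.projIcc (0:ℝ) 1 zero_le_one p.im) := by
    have e : (Complex.I - p).im = 1 - p.im := by simp
    rw [e]
    rcases le_total p.im 0 with h | h
    · rw [proj_bot h, proj_top (by linarith)]
      exact unitInterval.symm_zero.symm
    · rcases le_total 1 p.im with h1 | h1
      · rw [proj_top h1, proj_bot (by linarith)]
        exact unitInterval.symm_one.symm
      · rw [Set.projIcc_of_mem _ ⟨h, h1⟩, Set.projIcc_of_mem _ ⟨by linarith, by linarith⟩]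
        rfl
  simp only [Fh, hp]
  have e : (Complex.I - p).re = - p.re := by simp
  rw [e]
  apply Complex.ext
  · simp [cx, cF]
  · simp [cx, cF, unitInterval.symmHomeomorph]

theorem main_lr (h : Bd f F) (hl : ∀ x, (F (x, 0)).1 < x) (hr : ∀ x, x < (F (x, 1)).1) :
    ∃ a b : AddCircle (1:ℝ) × (Set.Icc (0:ℝ) 1), a ≠ b ∧ f a = a ∧ f b = b := by
  by_contra hcon
  push Not at hcon
  have hcon' : ∀ a b, f a = a → f b = b → a = b := by
    intro a b ha hb
    by_contra hab
    exact hcon a b hab ha hb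
  have hS := h.str hl hr
  obtain ⟨x0, y0, hy0, hy1, hfix⟩ : ∃ x0 y0 : ℝ, 0 ≤ y0 ∧ y0 ≤ 1 ∧
      ∀ p, Fh F p = p → p.im = y0 ∧ ∃ j : ℤ, p.re = x0 + j := by
    by_cases hex : ∃ p, Fh F p = p
    · obtain ⟨p, hp⟩ := hex
      obtain ⟨y, hy, hfy⟩ := h.fixed hp
      refine ⟨p.re, y, y.2.1, y.2.2, fun q hq => ?_⟩
      obtain ⟨y', hy', hfy'⟩ := h.fixed hq
      have := hcon' _ _ hfy' hfy
      rw [Prod.mk.injEq] at this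
      exact ⟨by rw [← hy', this.2], coe_eq_iff _ _ this.1⟩
    · exact ⟨0, 0, le_rfl, zero_le_one, fun p hp => absurd ⟨p, hp⟩ hex⟩
  obtain ⟨L, κ, hLc, hLe, hL0, hL1⟩ := exists_log hS x0 y0 hy0 hy1 hfix
  obtain ⟨p, q, hp, hq, hpq⟩ := core hS h.surj x0 (fun p hp => (hfix p hp).2)
    (fun ε hε => h.escape x0 ε hε) L hLc hLe
  rw [hL1 p hp, hL0 q hq] at hpq
  have hR : Bd (cf unitInterval.symmHomeomorph f) (cF unitInterval.symmHomeomorph F) :=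
    h.conj _ unitInterval.measurePreserving_symm
      (Or.inr ⟨unitInterval.symm_zero, unitInterval.symm_one⟩)
  have hs0 : unitInterval.symmHomeomorph 0 = 1 := unitInterval.symm_zero
  have hs1 : unitInterval.symmHomeomorph 1 = 0 := unitInterval.symm_one
  have hRS := hR.str (by intro x; simp only [cF, hs0]; linarith [hr (-x)])
    (by intro x; simp only [cF, hs1]; linarith [hl (-x)])
  have hne : ∀ p, Fh (cF unitInterval.symmHomeomorph F) p ≠ p →
      Fh F (Complex.I - p) ≠ Complex.I - p := by
    intro p hp he
    apply hp
    rw [Fh_conj, he]; ring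
  obtain ⟨p', q', hp', hq', hpq'⟩ := core hRS hR.surj (-x0)
    (by
      intro p hp
      rw [Fh_conj] at hp
      have : Fh F (Complex.I - p) = Complex.I - p := by linear_combination -hp
      obtain ⟨j, hj⟩ := (hfix _ this).2
      refine ⟨-j, ?_⟩
      simp at hj
      push_cast; linarith)
    (fun ε hε => hR.escape (-x0) ε hε) (fun p => L (Complex.I - p) + Real.pi * Complex.I)
    (by
      refine ContinuousOn.add (hLc.comp (by fun_prop) ?_) continuousOn_const
      rintro p ⟨h1, h2, h3⟩
      exact ⟨by simp; exact h2, by simp; exact h1, hne p h3⟩)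
    (by
      intro p h1 h2 h3
      rw [Complex.exp_add, Complex.exp_pi_mul_I, hLe _ (by simp; exact h2) (by simp; exact h1)
        (hne p h3), Fh_conj]
      ring)
  simp only [Complex.add_im] at hpq'
  rw [hL0 _ (by simp [hp']), hL1 _ (by simp [hq'])] at hpq'
  have := Real.pi_pos
  linarith

theorem rot_lt {g : ℝ → ℝ} (hg : StrictMono g) {k ρ : ℝ} (hk : ∀ x, g (x + k) = g x + k) {x : ℝ}
    (ht : Tendsto (fun n : ℕ => g^[n] x / n) atTop (𝓝 ρ)) (hρ : ρ < k) : g x < x + k := by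
  by_contra hcon
  rw [not_lt] at hcon
  have hc : Function.Commute g (fun x => x + k) := hk
  have hit : ∀ n : ℕ, x + n * k ≤ g^[n] x := by
    intro n
    induction n with
    | zero => simp
    | succ n ih =>
      rw [Function.iterate_succ_apply]
      have h1 := (hg.monotone.iterate n) hcon
      have h2 : g^[n] (x + k) = g^[n] x + k := (hc.iterate_left n) x
      rw [h2] at h1
      push_cast; linarith
  have hlim : Tendsto (fun n : ℕ => x / n + k) atTop (𝓝 (0 + k)) :=
    (tendsto_const_div_atTop_nhds_zero_nat x).add_const k
  have := le_of_tendsto_of_tendsto hlim ht (by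
    filter_upwards [eventually_gt_atTop 0] with n hn
    have hn' : (0:ℝ) < n := by exact_mod_cast hn
    rw [le_div_iff₀ hn', add_mul, div_mul_cancel₀ _ hn'.ne']
    linarith [hit n])
  linarith

theorem rot_gt {g : ℝ → ℝ} (hg : StrictMono g) {k ρ : ℝ} (hk : ∀ x, g (x + k) = g x + k) {x : ℝ}
    (ht : Tendsto (fun n : ℕ => g^[n] x / n) atTop (𝓝 ρ)) (hρ : k < ρ) : x + k < g x := by
  by_contra hcon
  rw [not_lt] at hcon
  have hc : Function.Commute g (fun x => x + k) := hk
  have hit : ∀ n : ℕ, g^[n] x ≤ x + n * k := by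
    intro n
    induction n with
    | zero => simp
    | succ n ih =>
      rw [Function.iterate_succ_apply]
      have h1 := (hg.monotone.iterate n) hcon
      have h2 : g^[n] (x + k) = g^[n] x + k := (hc.iterate_left n) x
      rw [h2] at h1
      push_cast; linarith
  have hlim : Tendsto (fun n : ℕ => x / n + k) atTop (𝓝 (0 + k)) :=
    (tendsto_const_div_atTop_nhds_zero_nat x).add_const k
  have := le_of_tendsto_of_tendsto ht hlim (by
    filter_upwards [eventually_gt_atTop 0] with n hn
    have hn' : (0:ℝ) < n := by exact_mod_cast hn
    rw [div_le_iff₀ hn', add_mul, div_mul_cancel₀ _ hn'.ne']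
    linarith [hit n])
  linarith

theorem Bd.shift (h : Bd f F) (k : ℤ) : Bd f (fun q => ((F q).1 - k, (F q).2)) where
  mp := h.mp
  b0 := h.b0
  b0s := h.b0s
  b1 := h.b1
  b1s := h.b1s
  cont := by have := h.cont; fun_prop
  lift x y := by
    rw [← h.lift]
    simp only
    have := coe_add_int (F (x, y)).1 (-k)
    rw [← this]; push_cast; rfl
  per x y := by simp only [h.per]; ring_nf

theorem iter_fst (c : Set.Icc (0:ℝ) 1) (hc : ∀ x, (F (x, c)).2 = c) (x : ℝ) (n : ℕ) :
    F^[n] (x, c) = ((fun x => (F (x, c)).1)^[n] x, c) := by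
  induction n with
  | zero => rfl
  | succ n ih =>
    rw [Function.iterate_succ_apply', Function.iterate_succ_apply', ih]
    exact Prod.ext rfl (hc _)

theorem Bd.main (h : Bd f F) (ρ₀ ρ₁ : ℝ)
    (hρ₀ : ∀ x : ℝ, Tendsto (fun n : ℕ => (F^[n] (x, 0)).1 / n) atTop (𝓝 ρ₀))
    (hρ₁ : ∀ x : ℝ, Tendsto (fun n : ℕ => (F^[n] (x, 1)).1 / n) atTop (𝓝 ρ₁))
    (k : ℤ) (hk₁ : min ρ₀ ρ₁ < k) (hk₂ : (k : ℝ) < max ρ₀ ρ₁) :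
    ∃ a b : AddCircle (1:ℝ) × (Set.Icc (0:ℝ) 1), a ≠ b ∧ f a = a ∧ f b = b := by
  simp only [iter_fst 0 h.F0] at hρ₀
  simp only [iter_fst 1 h.F1] at hρ₁
  have m0 := h.mono_b 0 h.F0
  have m1 := h.mono_b 1 h.F1
  have k0 : ∀ x, (fun x => (F (x, 0)).1) (x + k) = (fun x => (F (x, 0)).1) x + k := by
    intro x; simp only [h.per_int]
  have k1 : ∀ x, (fun x => (F (x, 1)).1) (x + k) = (fun x => (F (x, 1)).1) x + k := by
    intro x; simp only [h.per_int]
  have hs := h.shift k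
  rcases min_lt_iff.mp hk₁ with h1 | h1
  · have h2 : (k:ℝ) < ρ₁ := (lt_max_iff.mp hk₂).resolve_left (by linarith)
    apply main_lr hs
    · intro x
      have := rot_lt m0 k0 (hρ₀ x) h1
      simp only at this ⊢; linarith
    · intro x
      have := rot_gt m1 k1 (hρ₁ x) h2
      simp only at this ⊢; linarith
  · have h2 : (k:ℝ) < ρ₀ := (lt_max_iff.mp hk₂).resolve_right (by linarith)
    have hN := hs.conj (Homeomorph.refl _) (MeasurePreserving.id _) (Or.inl ⟨rfl, rfl⟩)
    obtain ⟨a, b, hab, ha, hb⟩ := main_lr hN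
      (by
        intro x
        have := rot_gt m0 k0 (hρ₀ (-x)) h2
        simp only [cF, Homeomorph.refl_apply, id] at this ⊢; linarith)
      (by
        intro x
        have := rot_lt m1 k1 (hρ₁ (-x)) h1
        simp only [cF, Homeomorph.refl_apply, id] at this ⊢; linarith)
    have hinv : ∀ a, refl2 (Homeomorph.refl _) (refl2 (Homeomorph.refl _) a) = a := by
      rintro ⟨a, y⟩
      simp [refl2_apply]
    have key : ∀ a, cf (Homeomorph.refl _) f a = a →
        f (refl2 (Homeomorph.refl _) a) = refl2 (Homeomorph.refl _) a := by
      intro a ha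
      have : refl2 (Homeomorph.refl _) (f (refl2 (Homeomorph.refl _) a)) = a := ha
      rw [← hinv (f _), this]
    exact ⟨refl2 (Homeomorph.refl _) a, refl2 (Homeomorph.refl _) b,
      fun e => hab ((refl2 (Homeomorph.refl _)).injective e), key a ha, key b hb⟩
end PB
end

/-- The Poincaré–Birkhoff fixed point theorem: an area-preserving homeomorphism of
the closed annulus `(ℝ/ℤ) × [0,1]` that preserves the two boundary circles and whose
lift has boundary rotation numbers `ρ₀, ρ₁` with an integer strictly between them
has at least two fixed points. -/
theorem poincare_birkhoff
    (f : (AddCircle (1:ℝ) × (Set.Icc (0:ℝ) 1)) ≃ₜ (AddCircle (1:ℝ) × (Set.Icc (0:ℝ) 1)))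
    (hmp : MeasurePreserving f volume volume)
    (hbd0 : (f : (AddCircle (1:ℝ) × (Set.Icc (0:ℝ) 1)) → _) ''
        (Set.univ ×ˢ {(⟨0, by norm_num⟩ : Set.Icc (0:ℝ) 1)})
        = Set.univ ×ˢ {(⟨0, by norm_num⟩ : Set.Icc (0:ℝ) 1)})
    (hbd1 : (f : (AddCircle (1:ℝ) × (Set.Icc (0:ℝ) 1)) → _) ''
        (Set.univ ×ˢ {(⟨1, by norm_num⟩ : Set.Icc (0:ℝ) 1)})
        = Set.univ ×ˢ {(⟨1, by norm_num⟩ : Set.Icc (0:ℝ) 1)})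
    (F : ℝ × (Set.Icc (0:ℝ) 1) → ℝ × (Set.Icc (0:ℝ) 1))
    (hFcont : Continuous F)
    (hFlift : ∀ (x : ℝ) (y : Set.Icc (0:ℝ) 1),
      (((F (x, y)).1 : AddCircle (1:ℝ)), (F (x, y)).2) = f ((x : AddCircle (1:ℝ)), y))
    (hFper : ∀ (x : ℝ) (y : Set.Icc (0:ℝ) 1),
      F (x + 1, y) = ((F (x, y)).1 + 1, (F (x, y)).2))
    (ρ₀ ρ₁ : ℝ)
    (hρ₀ : ∀ x : ℝ,
      Tendsto (fun n : ℕ => (F^[n] (x, ⟨0, by norm_num⟩)).1 / n) atTop (𝓝 ρ₀))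
    (hρ₁ : ∀ x : ℝ,
      Tendsto (fun n : ℕ => (F^[n] (x, ⟨1, by norm_num⟩)).1 / n) atTop (𝓝 ρ₁))
    (k : ℤ) (hk₁ : min ρ₀ ρ₁ < k) (hk₂ : (k : ℝ) < max ρ₀ ρ₁) :
    ∃ a b : AddCircle (1:ℝ) × (Set.Icc (0:ℝ) 1), a ≠ b ∧ f a = a ∧ f b = b := by
  have h : PB.Bd f F :=
    { mp := hmp
      b0 := fun a => by
        have : f (a, 0) ∈ f '' (Set.univ ×ˢ {(⟨0, by norm_num⟩ : Set.Icc (0:ℝ) 1)}) :=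
          ⟨(a, 0), ⟨trivial, rfl⟩, rfl⟩
        rw [hbd0] at this
        exact this.2
      b0s := fun a => by
        have : (a, 0) ∈ (Set.univ : Set (AddCircle (1:ℝ))) ×ˢ
          {(⟨0, by norm_num⟩ : Set.Icc (0:ℝ) 1)} := ⟨trivial, rfl⟩
        rw [← hbd0] at this
        obtain ⟨⟨b, y⟩, ⟨-, hy⟩, hb⟩ := this
        exact ⟨b, by rw [← hb]; congr; exact hy.symm⟩
      b1 := fun a => by
        have : f (a, 1) ∈ f '' (Set.univ ×ˢ {(⟨1, by norm_num⟩ : Set.Icc (0:ℝ) 1)}) :=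
          ⟨(a, 1), ⟨trivial, rfl⟩, rfl⟩
        rw [hbd1] at this
        exact this.2
      b1s := fun a => by
        have : (a, 1) ∈ (Set.univ : Set (AddCircle (1:ℝ))) ×ˢ
          {(⟨1, by norm_num⟩ : Set.Icc (0:ℝ) 1)} := ⟨trivial, rfl⟩
        rw [← hbd1] at this
        obtain ⟨⟨b, y⟩, ⟨-, hy⟩, hb⟩ := this
        exact ⟨b, by rw [← hb]; congr; exact hy.symm⟩
      cont := hFcont
      lift := hFlift
      per := hFper }
  exact h.main ρ₀ ρ₁ hρ₀ hρ₁ k hk₁ hk₂
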